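/- arXiv:math/0511223 — 2 statements merged into one kernel-verified Lean document; each statement's English description precedes it below -/
import Mathlib

section
/- Let r ≥ 1 and let G be a graph with 2r edges whose cycle matroid M(G) has rank r. Then the single exchange graph 𝔊(M(G)) is connected. -/
/-- Vertices touched by the edge set `T` in the multigraph `ends : E → V × V`. -/
def edgeVerts {V E : Type*} (ends : E → V × V) (T : Finset E) : Set V :=
  {v | ∃ e ∈ T, (ends e).1 = v ∨ (ends e).2 = v}

/-- `S` is a forest: every nonempty subset of edges touches more vertices than it has edges. -/
def IsForest {V E : Type*} (ends : E → V × V) (S : Finset E) : Prop :=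
  ∀ T ⊆ S, T.Nonempty → T.card < (edgeVerts ends T).ncard

/-- A spanning forest: a maximal forest, i.e. a base of the cycle matroid `M(G)`. -/
def IsSpanningForest {V E : Type*} [DecidableEq E] (ends : E → V × V) (B : Finset E) : Prop :=
  IsForest ends B ∧ ∀ e ∉ B, ¬ IsForest ends (insert e B)

/-- A vertex of the single exchange graph `𝔊(M(G))`: an ordered pair of disjoint bases. -/
def IsExchVertex {V E : Type*} [DecidableEq E] (ends : E → V × V)
    (P : Finset E × Finset E) : Prop :=
  IsSpanningForest ends P.1 ∧ IsSpanningForest ends P.2 ∧ Disjoint P.1 P.2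

section generic
set_option linter.unusedSectionVars false
variable {E K M : Type*} [DecidableEq E] [Field K] [AddCommGroup M] [Module K M]

def Ind (K : Type*) {E M : Type*} [Field K] [AddCommGroup M] [Module K M]
    (w : E → M) (B : Finset E) : Prop := LinearIndepOn K w (B : Set E)

lemma Ind.mono {w : E → M} {A B : Finset E} (h : Ind K w B) (hAB : A ⊆ B) : Ind K w A :=
  LinearIndepOn.mono h (by exact_mod_cast hAB)

lemma ind_insert_iff {w : E → M} {B : Finset E} {x : E} (hx : x ∉ B) :
    Ind K w (insert x B) ↔ Ind K w B ∧ w x ∉ Submodule.span K (w '' (B : Set E)) := by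
  unfold Ind
  rw [Finset.coe_insert, linearIndepOn_insert (by simpa using hx)]

lemma span_ker {w : E → M} {B : Finset E} {f : M →ₗ[K] K} (h : ∀ y ∈ B, f (w y) = 0)
    {m : M} (hm : m ∈ Submodule.span K (w '' (B : Set E))) : f m = 0 := by
  have : Submodule.span K (w '' (B : Set E)) ≤ LinearMap.ker f := by
    rw [Submodule.span_le]
    rintro _ ⟨y, hy, rfl⟩
    exact h y (by simpa using hy)
  exact this hm

lemma Ind.insert_f {w : E → M} {B : Finset E} {x : E} (f : M →ₗ[K] K) (hB : Ind K w B)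
    (h : ∀ y ∈ B, f (w y) = 0) (hx : f (w x) ≠ 0) : Ind K w (insert x B) := by
  have hxB : x ∉ B := fun hh => hx (h x hh)
  rw [ind_insert_iff hxB]
  exact ⟨hB, fun hm => hx (span_ker h hm)⟩

lemma exchange {w : E → M} {Y : Finset E} {a b c : E} (f : M →ₗ[K] K)
    (hI : Ind K w (insert b (insert c Y))) (hY : ∀ y ∈ Y, f (w y) = 0)
    (hab : a ≠ b) (hac : a ≠ c) (hbc : b ≠ c)
    (ha : f (w a) ≠ 0) (hb : f (w b) ≠ 0) (hc : f (w c) ≠ 0) :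
    Ind K w (insert a (insert c Y)) ∨ Ind K w (insert a (insert b Y)) := by
  have haY : a ∉ Y := fun hh => ha (hY a hh)
  have hbY : b ∉ Y := fun hh => hb (hY b hh)
  have hcY : c ∉ Y := fun hh => hc (hY c hh)
  have hIc : Ind K w (insert c Y) := hI.mono (Finset.subset_insert _ _)
  have hIb : Ind K w (insert b Y) :=
    hI.mono (Finset.insert_subset_insert _ (Finset.subset_insert _ _))
  by_contra! hcon
  obtain ⟨h1, h2⟩ := hcon
  rw [ind_insert_iff (by simp [*])] at h1 h2
  simp only [hIc, hIb, true_and, not_not, Finset.coe_insert, Set.image_insert_eq,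
    Submodule.mem_span_insert] at h1 h2
  obtain ⟨γ, z, hz, h1⟩ := h1
  obtain ⟨β, y, hy, h2⟩ := h2
  rw [ind_insert_iff (by simp [*])] at hI
  apply hI.2
  rw [Finset.coe_insert, Set.image_insert_eq, Submodule.mem_span_insert]
  have hfa : f (w a) = β * f (w b) := by rw [h2]; simp [span_ker hY hy]
  have hβ : β ≠ 0 := by rintro rfl; simp [hfa] at ha
  refine ⟨β⁻¹ * γ, β⁻¹ • (z - y), Submodule.smul_mem _ _ (Submodule.sub_mem _ hz hy), ?_⟩
  have : β • w b = γ • w c + (z - y) := by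
    have := h1.symm.trans h2
    rw [add_sub, this]; abel
  rw [mul_smul, ← smul_add, ← this, smul_smul, inv_mul_cancel₀ hβ, one_smul]

lemma ind_congr {w w' : E → M} {B : Finset E} (h : ∀ e ∈ B, w e = w' e) :
    Ind K w B ↔ Ind K w' B := by
  unfold Ind
  exact linearIndepOn_congr (fun e he => h e (by simpa using he))

lemma ind_update {w w' : E → M} {B : Finset E} {b c : E} (f : M →ₗ[K] K)
    (hw : ∀ e, e ≠ b → w' e = w e) (hwb : w' b = w b + w c)
    (hB : ∀ y ∈ B, f (w y) = 0) (hbc : b ≠ c)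
    (hb : f (w b) ≠ 0) (hc : f (w c) ≠ 0) (hs : f (w b + w c) = 0) :
    Ind K w' (insert b B) ↔ Ind K w (insert b (insert c B)) := by
  have hbB : b ∉ B := fun hh => hb (hB b hh)
  have hcB : c ∉ B := fun hh => hc (hB c hh)
  have hne : ∀ e ∈ B, w' e = w e := fun e he => hw e (fun h => hbB (h ▸ he))
  have him : w' '' (B : Set E) = w '' (B : Set E) :=
    Set.image_congr (fun e he => hne e (by simpa using he))
  rw [ind_insert_iff hbB, ind_insert_iff (by simp [*]), him, hwb, ind_congr hne]
  constructor
  · rintro ⟨h1, h2⟩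
    refine ⟨h1.insert_f f hB hc, fun h3 => h2 ?_⟩
    rw [Finset.coe_insert, Set.image_insert_eq, Submodule.mem_span_insert] at h3
    obtain ⟨γ, y, hy, h3⟩ := h3
    have hy0 := span_ker hB hy
    have : (γ + 1) * f (w c) = 0 := by
      rw [h3] at hs
      simp [hy0] at hs
      linear_combination hs
    have hγ : γ = -1 := by
      rcases mul_eq_zero.1 this with h | h
      · linear_combination h
      · exact absurd h hc
    have : w b + w c = y := by rw [h3, hγ]; simp
    rw [this]; exact hy
  · rintro ⟨h1, h2⟩
    refine ⟨h1.mono (Finset.subset_insert _ _), fun h3 => h2 ?_⟩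
    rw [Finset.coe_insert, Set.image_insert_eq, Submodule.mem_span_insert]
    exact ⟨-1, _, h3, by simp⟩

def Valid (K : Type*) {E M : Type*} [DecidableEq E] [Field K] [AddCommGroup M] [Module K M]
    (w : E → M) (S : Finset E) (r : ℕ) (A : Finset E) : Prop :=
  A ⊆ S ∧ Ind K w A ∧ Ind K w (S \ A) ∧ A.card = r ∧ (S \ A).card = r

def Step (K : Type*) {E M : Type*} [DecidableEq E] [Field K] [AddCommGroup M] [Module K M]
    (w : E → M) (S : Finset E) (r : ℕ) (A B : Finset E) : Prop :=
  Valid K w S r A ∧ Valid K w S r B ∧ (A ∩ B).card + 1 = r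

lemma Step.symm {w : E → M} {S : Finset E} {r : ℕ} {A B : Finset E} (h : Step K w S r A B) :
    Step K w S r B A := ⟨h.2.1, h.1, by rw [Finset.inter_comm]; exact h.2.2⟩

abbrev Conn (K : Type*) {E M : Type*} [DecidableEq E] [Field K] [AddCommGroup M] [Module K M]
    (w : E → M) (S : Finset E) (r : ℕ) := Relation.ReflTransGen (Step K w S r)

lemma Conn.symm {w : E → M} {S : Finset E} {r : ℕ} {A B : Finset E} (h : Conn K w S r A B) :
    Conn K w S r B A := by
  induction h with
  | refl => exact .refl
  | tail _ h2 ih => exact Relation.ReflTransGen.head h2.symm ih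

lemma Valid.compl {w : E → M} {S : Finset E} {r : ℕ} {A : Finset E} (h : Valid K w S r A) :
    Valid K w S r (S \ A) := by
  obtain ⟨h1, h2, h3, h4, h5⟩ := h
  have : S \ (S \ A) = A := by simpa using h1
  exact ⟨Finset.sdiff_subset, h3, by rwa [this], h5, by rwa [this]⟩

/-- swapping one element gives a step -/
lemma step_swap {w : E → M} {S : Finset E} {r : ℕ} {A : Finset E} {x y : E}
    (h : Valid K w S r A) (hx : x ∈ A) (hyS : y ∈ S) (hy : y ∉ A)
    (h1 : Ind K w (insert y (A.erase x))) (h2 : Ind K w (insert x ((S \ A).erase y))) :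
    Step K w S r A (insert y (A.erase x)) := by
  have e : S \ (insert y (A.erase x)) = insert x ((S \ A).erase y) := by
    have := h.1 hx
    ext z; simp only [Finset.mem_sdiff, Finset.mem_insert, Finset.mem_erase]
    grind
  have hr : 1 ≤ r := by rw [← h.2.2.2.1]; exact Finset.card_pos.2 ⟨x, hx⟩
  refine ⟨h, ⟨?_, h1, by rwa [e], ?_, ?_⟩, ?_⟩
  · exact Finset.insert_subset hyS ((Finset.erase_subset _ _).trans h.1)
  · rw [Finset.card_insert_of_notMem (by simp [hy]), Finset.card_erase_of_mem hx, h.2.2.2.1]; omega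
  · rw [e, Finset.card_insert_of_notMem (by simp [hx]),
      Finset.card_erase_of_mem (by simp [hyS, hy]), h.2.2.2.2]; omega
  · have : A ∩ insert y (A.erase x) = A.erase x := by
      ext z; simp only [Finset.mem_inter, Finset.mem_insert, Finset.mem_erase]; grind
    rw [this, Finset.card_erase_of_mem hx, h.2.2.2.1]; omega

/-- a valid set meets every cocycle -/
lemma Valid.meets {w : E → M} {S : Finset E} {r : ℕ} {A : Finset E} (f : M →ₗ[K] K)
    (h : Valid K w S r A) (hR : ∀ I ⊆ S, Ind K w I → I.card ≤ r) {x : E} (hxS : x ∈ S)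
    (hx : f (w x) ≠ 0) : ∃ y ∈ A, f (w y) ≠ 0 := by
  by_contra! hcon
  have h1 := h.2.1.insert_f f hcon hx
  have h2 := hR _ (Finset.insert_subset hxS h.1) h1
  rw [Finset.card_insert_of_notMem (fun hh => hx (hcon x hh)), h.2.2.2.1] at h2
  omega

/-- degree two case -/
lemma case_two {w : E → M} {S : Finset E} {r : ℕ} {a b : E} (f : M →ₗ[K] K) (hab : a ≠ b)
    (hR : ∀ I ⊆ S, Ind K w I → I.card ≤ r + 1)
    (haS : a ∈ S) (hbS : b ∈ S) (ha : f (w a) ≠ 0) (hb : f (w b) ≠ 0)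
    (h0 : ∀ e ∈ S, e ≠ a → e ≠ b → f (w e) = 0)
    (IH : (∀ I ⊆ (S.erase a).erase b, Ind K w I → I.card ≤ r) → ∀ P Q,
      Valid K w ((S.erase a).erase b) r P → Valid K w ((S.erase a).erase b) r Q →
      Conn K w ((S.erase a).erase b) r P Q)
    (P Q : Finset E) (hP : Valid K w S (r+1) P) (hQ : Valid K w S (r+1) Q) :
    Conn K w S (r+1) P Q := by
  have hfI : ∀ I ⊆ (S.erase a).erase b, ∀ y ∈ I, f (w y) = 0 := by
    intro I hI y hy
    have := hI hy
    simp only [Finset.mem_erase] at this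
    exact h0 y this.2.2 this.2.1 this.1
  have IH := IH (by
    intro I hI hInd
    have h1 := hInd.insert_f f (hfI I hI) ha
    have hsub : I ⊆ S := hI.trans ((Finset.erase_subset _ _).trans (Finset.erase_subset _ _))
    have h2 := hR _ (Finset.insert_subset haS hsub) h1
    rw [Finset.card_insert_of_notMem (fun hh => ha (hfI I hI a hh))] at h2
    omega)
  have one : ∀ P, Valid K w S (r+1) P → (a ∈ P ↔ b ∉ P) := by
    intro P hP
    obtain ⟨y, hy, hy'⟩ := hP.meets f hR haS ha
    obtain ⟨z, hz, hz'⟩ := hP.compl.meets f hR haS ha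
    have hya := h0 y (hP.1 hy)
    have hza := h0 z (Finset.sdiff_subset hz)
    simp only [Finset.mem_sdiff] at hz
    have hya : y = a ∨ y = b := by tauto
    have hza : z = a ∨ z = b := by tauto
    obtain ⟨-, hz⟩ := hz
    rcases hya with rfl | rfl <;> rcases hza with rfl | rfl <;> tauto
  -- lifting
  have lift : ∀ X, Valid K w ((S.erase a).erase b) r X → Valid K w S (r+1) (insert a X) := by
    rintro X ⟨h1, h2, h3, h4, h5⟩
    have hsub : X ⊆ S := h1.trans ((Finset.erase_subset _ _).trans (Finset.erase_subset _ _))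
    have e : S \ insert a X = insert b (((S.erase a).erase b) \ X) := by
      have : b ∉ X := fun hh => by simpa using h1 hh
      ext z; simp only [Finset.mem_sdiff, Finset.mem_insert, Finset.mem_erase]; grind
    refine ⟨Finset.insert_subset haS hsub, h2.insert_f f (hfI X h1) ha, ?_, ?_, ?_⟩
    · rw [e]; exact h3.insert_f f (hfI _ Finset.sdiff_subset) hb
    · rw [Finset.card_insert_of_notMem (fun hh => ha (hfI X h1 a hh)), h4]
    · rw [e, Finset.card_insert_of_notMem (by simp), h5]
  have liftC : ∀ X Y, Conn K w ((S.erase a).erase b) r X Y →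
      Conn K w S (r+1) (insert a X) (insert a Y) := by
    intro X Y h
    refine Relation.ReflTransGen.rec .refl (fun {Y Z} _ hst ih => ih.tail ?_) h
    obtain ⟨h1, h2, h3⟩ := hst
    refine ⟨lift _ h1, lift _ h2, ?_⟩
    rw [← Finset.insert_inter_distrib, Finset.card_insert_of_notMem, h3]
    intro hh
    have := h1.1 (Finset.mem_inter.1 hh).1
    simp at this
  have down : ∀ P, Valid K w S (r+1) P → a ∈ P → Valid K w ((S.erase a).erase b) r (P.erase a) := by
    intro P hP haP
    have hbP := (one P hP).1 haP
    obtain ⟨h1, h2, h3, h4, h5⟩ := hP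
    have e : ((S.erase a).erase b) \ (P.erase a) = (S \ P).erase b := by
      ext z; simp only [Finset.mem_sdiff, Finset.mem_erase]; grind
    refine ⟨?_, h2.mono (Finset.erase_subset _ _), ?_, ?_, ?_⟩
    · intro z hz
      simp only [Finset.mem_erase] at hz ⊢
      exact ⟨fun h => hbP (h ▸ hz.2), hz.1, h1 hz.2⟩
    · rw [e]; exact h3.mono (Finset.erase_subset _ _)
    · rw [Finset.card_erase_of_mem haP, h4]; rfl
    · rw [e, Finset.card_erase_of_mem (by simp [hbS, hbP]), h5]; rfl
  have both : ∀ P Q, Valid K w S (r+1) P → Valid K w S (r+1) Q → a ∈ P → a ∈ Q →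
      Conn K w S (r+1) P Q := by
    intro P Q hP hQ haP haQ
    have := liftC _ _ (IH _ _ (down P hP haP) (down Q hQ haQ))
    rwa [Finset.insert_erase haP, Finset.insert_erase haQ] at this
  have toA : ∀ P, Valid K w S (r+1) P → ∃ P', Valid K w S (r+1) P' ∧ a ∈ P' ∧
      Conn K w S (r+1) P P' := by
    intro P hP
    by_cases haP : a ∈ P
    · exact ⟨P, hP, haP, .refl⟩
    have hbP : b ∈ P := by by_contra h; exact haP ((one P hP).2 h)
    have hst : Step K w S (r+1) P (insert a (P.erase b)) := by
      apply step_swap hP hbP haS haP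
      · refine (hP.2.1.mono (Finset.erase_subset _ _)).insert_f f ?_ ha
        intro y hy
        simp only [Finset.mem_erase] at hy
        exact h0 y (hP.1 hy.2) (fun h => haP (h ▸ hy.2)) hy.1
      · refine (hP.2.2.1.mono (Finset.erase_subset _ _)).insert_f f ?_ hb
        intro y hy
        simp only [Finset.mem_erase, Finset.mem_sdiff] at hy
        exact h0 y hy.2.1 hy.1 (fun h => hy.2.2 (h ▸ hbP))
    exact ⟨_, hst.2.1, by simp, .single hst⟩
  obtain ⟨P', hP', haP', hPP⟩ := toA P hP
  obtain ⟨Q', hQ', haQ', hQQ⟩ := toA Q hQ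
  exact (hPP.trans (both _ _ hP' hQ' haP' haQ')).trans (Conn.symm hQQ)

lemma Step.compl {w : E → M} {S : Finset E} {r : ℕ} {A B : Finset E} (h : Step K w S r A B) :
    Step K w S r (S \ A) (S \ B) := by
  refine ⟨h.1.compl, h.2.1.compl, ?_⟩
  have e : (S \ A) ∩ (S \ B) = S \ (A ∪ B) := by
    ext z; simp only [Finset.mem_sdiff, Finset.mem_inter, Finset.mem_union]; tauto
  have h1 := Finset.card_sdiff_add_card_eq_card (Finset.union_subset h.1.1 h.2.1.1)
  have h2 := Finset.card_sdiff_add_card_eq_card h.1.1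
  have h3 := Finset.card_union_add_card_inter A B
  have h4 := h.2.2
  have h5 := h.1.2.2.2
  have h6 := h.2.1.2.2.2
  rw [e]; omega

def Cls {E : Type*} (a b c : E) (A : Finset E) : Prop :=
  (a ∈ A ∧ b ∉ A ∧ c ∉ A) ∨ (a ∉ A ∧ b ∈ A ∧ c ∈ A)

lemma swap_three {w : E → M} {S : Finset E} {r : ℕ} {a b c : E} (f : M →ₗ[K] K)
    (hab : a ≠ b) (hac : a ≠ c) (hbc : b ≠ c)
    (hbS : b ∈ S) (hcS : c ∈ S)
    (ha : f (w a) ≠ 0) (hb : f (w b) ≠ 0) (hc : f (w c) ≠ 0)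
    (h0 : ∀ e ∈ S, e ≠ a → e ≠ b → e ≠ c → f (w e) = 0)
    {A : Finset E} (hA : Valid K w S r A) (haA : a ∈ A) (hbA : b ∉ A) (hcA : c ∉ A) :
    ∃ s, (s = b ∨ s = c) ∧ Step K w S r A (insert s (A.erase a)) := by
  have hX : ∀ y ∈ A.erase a, f (w y) = 0 := by
    intro y hy
    rw [Finset.mem_erase] at hy
    exact h0 y (hA.1 hy.2) hy.1 (fun h => hbA (h ▸ hy.2)) (fun h => hcA (h ▸ hy.2))
  have hXI := hA.2.1.mono (Finset.erase_subset a A)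
  have e1 : insert c (((S \ A).erase b).erase c) = (S \ A).erase b :=
    Finset.insert_erase (by simp [hcS, hcA, hbc.symm])
  have e2 : insert b (((S \ A).erase b).erase c) = (S \ A).erase c := by
    rw [Finset.erase_right_comm]
    exact Finset.insert_erase (by simp [hbS, hbA, hbc])
  have e3 : insert b (insert c (((S \ A).erase b).erase c)) = S \ A := by
    rw [e1]; exact Finset.insert_erase (by simp [hbS, hbA])
  have hY : ∀ y ∈ ((S \ A).erase b).erase c, f (w y) = 0 := by
    intro y hy
    simp only [Finset.mem_erase, Finset.mem_sdiff] at hy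
    exact h0 y hy.2.2.1 (fun h => hy.2.2.2 (h ▸ haA)) hy.2.1 hy.1
  have := exchange f (Y := ((S \ A).erase b).erase c) (by rw [e3]; exact hA.2.2.1) hY
    hab hac hbc ha hb hc
  rw [e1, e2] at this
  rcases this with h | h
  · exact ⟨b, .inl rfl, step_swap hA haA hbS hbA (hXI.insert_f f hX hb) h⟩
  · exact ⟨c, .inr rfl, step_swap hA haA hcS hcA (hXI.insert_f f hX hc) h⟩

lemma cls_neighbor {w : E → M} {S : Finset E} {r : ℕ} {a b c : E} (f : M →ₗ[K] K)
    (hab : a ≠ b) (hac : a ≠ c) (hbc : b ≠ c)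
    (haS : a ∈ S) (hbS : b ∈ S) (hcS : c ∈ S)
    (ha : f (w a) ≠ 0) (hb : f (w b) ≠ 0) (hc : f (w c) ≠ 0)
    (h0 : ∀ e ∈ S, e ≠ a → e ≠ b → e ≠ c → f (w e) = 0)
    {A : Finset E} (hA : Valid K w S r A) (hcl : Cls a b c A) :
    ∃ B, Step K w S r A B ∧ (Cls b a c B ∨ Cls c a b B) := by
  rcases hcl with ⟨h1, h2, h3⟩ | ⟨h1, h2, h3⟩
  · obtain ⟨s, hs, hst⟩ := swap_three f hab hac hbc hbS hcS ha hb hc h0 hA h1 h2 h3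
    refine ⟨_, hst, ?_⟩
    unfold Cls
    simp only [Finset.mem_insert, Finset.mem_erase]
    clear hst h0
    grind
  · obtain ⟨s, hs, hst⟩ := swap_three f hab hac hbc hbS hcS ha hb hc h0 hA.compl
      (by simp [*]) (by simp [*]) (by simp [*])
    have h4 := hst.compl
    have e : S \ (S \ A) = A := by simpa using hA.1
    rw [e] at h4
    refine ⟨_, h4, ?_⟩
    unfold Cls
    simp only [Finset.mem_sdiff, Finset.mem_insert, Finset.mem_erase]
    clear hst h0 h4
    grind

lemma cls_conn {w w' : E → M} {S : Finset E} {r : ℕ} {a b c : E} (f : M →ₗ[K] K)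
    (hab : a ≠ b) (hac : a ≠ c) (hbc : b ≠ c)
    (haS : a ∈ S) (hbS : b ∈ S) (hcS : c ∈ S)
    (ha : f (w a) ≠ 0) (hb : f (w b) ≠ 0) (hc : f (w c) ≠ 0)
    (h0 : ∀ e ∈ S, e ≠ a → e ≠ b → e ≠ c → f (w e) = 0)
    (hR : ∀ I ⊆ S, Ind K w I → I.card ≤ r + 1)
    (hw : ∀ e, e ≠ b → w' e = w e) (hwb : w' b = w b + w c) (hs : f (w b + w c) = 0)
    (IH : (∀ I ⊆ (S.erase a).erase c, Ind K w' I → I.card ≤ r) → ∀ P Q,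
      Valid K w' ((S.erase a).erase c) r P → Valid K w' ((S.erase a).erase c) r Q →
      Conn K w' ((S.erase a).erase c) r P Q)
    (P Q : Finset E) (hP : Valid K w S (r+1) P) (hQ : Valid K w S (r+1) Q)
    (hPc : Cls a b c P) (hQc : Cls a b c Q) :
    Conn K w S (r+1) P Q := by
  have hsS : (S.erase a).erase c ⊆ S := (Finset.erase_subset _ _).trans (Finset.erase_subset _ _)
  have hne : ∀ Z ⊆ (S.erase a).erase c, a ∉ Z ∧ c ∉ Z := by
    intro Z hZ
    exact ⟨fun h => by simpa using hZ h, fun h => by simpa using hZ h⟩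
  have hker : ∀ Z ⊆ (S.erase a).erase c, ∀ y ∈ Z.erase b, f (w y) = 0 := by
    intro Z hZ y hy
    rw [Finset.mem_erase] at hy
    have := hZ hy.2
    simp only [Finset.mem_erase] at this
    exact h0 y this.2.2 this.2.1 hy.1 this.1
  have up1 : ∀ Z ⊆ (S.erase a).erase c, b ∈ Z → (Ind K w' Z ↔ Ind K w (insert c Z)) := by
    intro Z hZ hbZ
    have := ind_update f hw hwb (hker Z hZ) hbc hb hc hs
    rwa [Finset.insert_comm, Finset.insert_erase hbZ] at this
  have up2 : ∀ Z, b ∉ Z → (Ind K w' Z ↔ Ind K w Z) := by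
    intro Z hbZ
    exact ind_congr (fun e he => hw e (fun h => hbZ (h ▸ he)))
  have up3 : ∀ Z ⊆ (S.erase a).erase c, b ∉ Z → Ind K w' Z → ∀ x, f (w x) ≠ 0 →
      Ind K w (insert x Z) := by
    intro Z hZ hbZ hI x hx
    refine ((up2 Z hbZ).1 hI).insert_f f ?_ hx
    have := hker Z hZ
    rwa [Finset.erase_eq_of_notMem hbZ] at this
  have IH := IH (by
    intro I hI hInd
    have h1 : Ind K w (insert c I) := by
      by_cases hbI : b ∈ I
      · exact (up1 I hI hbI).1 hInd
      · exact up3 I hI hbI hInd c hc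
    have h2 := hR _ (Finset.insert_subset hcS (hI.trans hsS)) h1
    rw [Finset.card_insert_of_notMem (hne I hI).2] at h2
    omega)
  set φ : Finset E → Finset E := fun X => if b ∈ X then insert c X else insert a X with hφ
  have hbS' : b ∈ (S.erase a).erase c := by simp [hbS, hab.symm, hbc]
  have φ1 : ∀ X, b ∈ X → φ X = insert c X := fun X h => by simp [hφ, h]
  have φ2 : ∀ X, b ∉ X → φ X = insert a X := fun X h => by simp [hφ, h]
  have lift : ∀ X, Valid K w' ((S.erase a).erase c) r X → Valid K w S (r+1) (φ X) := by
    rintro X ⟨h1, h2, h3, h4, h5⟩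
    have hn := hne X h1
    by_cases hbX : b ∈ X
    · have e : S \ insert c X = insert a (((S.erase a).erase c) \ X) := by
        ext z; simp only [Finset.mem_sdiff, Finset.mem_insert, Finset.mem_erase]
        clear IH h0 hker up1 up2 up3 φ1 φ2 hR hw hne
        grind
      rw [φ1 X hbX]
      refine ⟨Finset.insert_subset hcS (h1.trans hsS), (up1 X h1 hbX).1 h2, ?_, ?_, ?_⟩
      · rw [e]; exact up3 _ Finset.sdiff_subset (by simp [hbX]) h3 a ha
      · rw [Finset.card_insert_of_notMem hn.2, h4]
      · rw [e, Finset.card_insert_of_notMem (by simp), h5]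
    · have e : S \ insert a X = insert c (((S.erase a).erase c) \ X) := by
        ext z; simp only [Finset.mem_sdiff, Finset.mem_insert, Finset.mem_erase]
        clear IH h0 hker up1 up2 up3 φ1 φ2 hR hw hne
        grind
      rw [φ2 X hbX]
      refine ⟨Finset.insert_subset haS (h1.trans hsS), up3 X h1 hbX h2 a ha, ?_, ?_, ?_⟩
      · rw [e]
        exact (up1 _ Finset.sdiff_subset (Finset.mem_sdiff.2 ⟨hbS', hbX⟩)).1 h3
      · rw [Finset.card_insert_of_notMem hn.1, h4]
      · rw [e, Finset.card_insert_of_notMem (by simp), h5]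
  have mixed : ∀ X Y, Step K w' ((S.erase a).erase c) r X Y → b ∉ X → b ∈ Y →
      Conn K w S (r+1) (φ X) (φ Y) := by
    rintro X Y ⟨h1, h2, h3⟩ hbX hbY
    have hnX := hne X h1.1
    have hnY := hne Y h2.1
    have l1 := lift X h1
    have l2 := lift Y h2
    rw [φ2 X hbX] at l1 ⊢
    rw [φ1 Y hbY] at l2 ⊢
    obtain ⟨s, hs, hst⟩ := swap_three f hab hac hbc hbS hcS ha hb hc h0 l1 (by simp)
      (by simp [hbX, hab.symm]) (by simp [hnX.2, hac.symm])
    rw [Finset.erase_insert hnX.1] at hst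
    refine (Relation.ReflTransGen.single hst).tail ⟨hst.2.1, l2, ?_⟩
    have e : insert s X ∩ insert c Y = insert s (X ∩ Y) := by
      ext z; simp only [Finset.mem_inter, Finset.mem_insert]
      clear IH h0 hker up1 up2 up3 φ1 φ2 hR hw hne lift
      grind
    have hsX : s ∉ X := by rcases hs with rfl | rfl; exacts [hbX, hnX.2]
    rw [e, Finset.card_insert_of_notMem (by simp [hsX]), h3]
  have liftStep : ∀ X Y, Step K w' ((S.erase a).erase c) r X Y →
      Conn K w S (r+1) (φ X) (φ Y) := by
    intro X Y hst
    have hnX := hne X hst.1.1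
    by_cases hbX : b ∈ X <;> by_cases hbY : b ∈ Y
    · refine .single ⟨lift X hst.1, lift Y hst.2.1, ?_⟩
      rw [φ1 X hbX, φ1 Y hbY, ← Finset.insert_inter_distrib,
        Finset.card_insert_of_notMem (by simp [hnX.2]), hst.2.2]
    · exact Conn.symm (mixed Y X hst.symm hbY hbX)
    · exact mixed X Y hst hbX hbY
    · refine .single ⟨lift X hst.1, lift Y hst.2.1, ?_⟩
      rw [φ2 X hbX, φ2 Y hbY, ← Finset.insert_inter_distrib,
        Finset.card_insert_of_notMem (by simp [hnX.1]), hst.2.2]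
  have liftC : ∀ X Y, Conn K w' ((S.erase a).erase c) r X Y →
      Conn K w S (r+1) (φ X) (φ Y) := by
    intro X Y h
    exact Relation.ReflTransGen.rec .refl (fun {Y Z} _ hst ih => ih.trans (liftStep _ _ hst)) h
  have down : ∀ P, Valid K w S (r+1) P → Cls a b c P →
      ∃ X, φ X = P ∧ Valid K w' ((S.erase a).erase c) r X := by
    rintro P ⟨h1, h2, h3, h4, h5⟩ (⟨p1, p2, p3⟩ | ⟨p1, p2, p3⟩)
    · have hZ : P.erase a ⊆ (S.erase a).erase c := by
        intro z hz
        simp only [Finset.mem_erase] at hz ⊢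
        exact ⟨fun h => p3 (h ▸ hz.2), hz.1, h1 hz.2⟩
      have e : ((S.erase a).erase c) \ P.erase a = (S \ P).erase c := by
        ext z; simp only [Finset.mem_sdiff, Finset.mem_erase]
        clear IH h0 hker up1 up2 up3 φ1 φ2 hR hw hne lift mixed liftStep liftC
        grind
      have hcm : c ∈ S \ P := by simp [hcS, p3]
      refine ⟨P.erase a, ?_, hZ, ?_, ?_, ?_, ?_⟩
      · rw [φ2 _ (by simp [p2]), Finset.insert_erase p1]
      · exact (up2 _ (by simp [p2])).2 (h2.mono (Finset.erase_subset _ _))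
      · have hb' : b ∈ (S \ P).erase c := by simp [hbS, p2, hbc]
        rw [e, up1 _ (e ▸ Finset.sdiff_subset) hb', Finset.insert_erase hcm]
        exact h3
      · rw [Finset.card_erase_of_mem p1, h4]; rfl
      · rw [e, Finset.card_erase_of_mem hcm, h5]; rfl
    · have hZ : P.erase c ⊆ (S.erase a).erase c := by
        intro z hz
        simp only [Finset.mem_erase] at hz ⊢
        exact ⟨hz.1, fun h => p1 (h ▸ hz.2), h1 hz.2⟩
      have e : ((S.erase a).erase c) \ P.erase c = (S \ P).erase a := by
        ext z; simp only [Finset.mem_sdiff, Finset.mem_erase]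
        clear IH h0 hker up1 up2 up3 φ1 φ2 hR hw hne lift mixed liftStep liftC
        grind
      have ham : a ∈ S \ P := by simp [haS, p1]
      have hb' : b ∈ P.erase c := by simp [p2, hbc]
      refine ⟨P.erase c, ?_, hZ, ?_, ?_, ?_, ?_⟩
      · rw [φ1 _ hb', Finset.insert_erase p3]
      · rw [up1 _ hZ hb', Finset.insert_erase p3]
        exact h2
      · rw [e]
        exact (up2 _ (by simp [p2])).2 (h3.mono (Finset.erase_subset _ _))
      · rw [Finset.card_erase_of_mem p3, h4]; rfl
      · rw [e, Finset.card_erase_of_mem ham, h5]; rfl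
  obtain ⟨X, rfl, hX⟩ := down P hP hPc
  obtain ⟨Y, rfl, hY⟩ := down Q hQ hQc
  exact liftC _ _ (IH X Y hX hY)

lemma Cls.comm {a b c : E} {A : Finset E} (h : Cls a b c A) : Cls a c b A := by
  unfold Cls at *; tauto

lemma cls_some {a b c : E} {A : Finset E} (h1 : a ∈ A ∨ b ∈ A ∨ c ∈ A)
    (h2 : a ∉ A ∨ b ∉ A ∨ c ∉ A) : Cls a b c A ∨ Cls b a c A ∨ Cls c a b A := by
  unfold Cls
  by_cases a ∈ A <;> by_cases b ∈ A <;> by_cases c ∈ A <;> simp_all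

lemma case_three {w : E → M} {S : Finset E} {r : ℕ} {a b c : E} (f : M →ₗ[K] K)
    (hab : a ≠ b) (hac : a ≠ c) (hbc : b ≠ c)
    (haS : a ∈ S) (hbS : b ∈ S) (hcS : c ∈ S)
    (ha : f (w a) ≠ 0) (hb : f (w b) ≠ 0) (hc : f (w c) ≠ 0)
    (h0 : ∀ e ∈ S, e ≠ a → e ≠ b → e ≠ c → f (w e) = 0)
    (hR : ∀ I ⊆ S, Ind K w I → I.card ≤ r)
    (Ha : ∀ P Q, Valid K w S r P → Valid K w S r Q → Cls a b c P → Cls a b c Q → Conn K w S r P Q)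
    (Hb : ∀ P Q, Valid K w S r P → Valid K w S r Q → Cls b a c P → Cls b a c Q → Conn K w S r P Q)
    (Hc : ∀ P Q, Valid K w S r P → Valid K w S r Q → Cls c a b P → Cls c a b Q → Conn K w S r P Q)
    (P Q : Finset E) (hP : Valid K w S r P) (hQ : Valid K w S r Q) : Conn K w S r P Q := by
  have some : ∀ P, Valid K w S r P → Cls a b c P ∨ Cls b a c P ∨ Cls c a b P := by
    intro P hP
    obtain ⟨y, hy, hy'⟩ := hP.meets f hR haS ha
    obtain ⟨z, hz, hz'⟩ := hP.compl.meets f hR haS ha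
    have hya := h0 y (hP.1 hy)
    have hza := h0 z (Finset.sdiff_subset hz)
    simp only [Finset.mem_sdiff] at hz
    have hya : y = a ∨ y = b ∨ y = c := by tauto
    have hza : z = a ∨ z = b ∨ z = c := by tauto
    obtain ⟨-, hz⟩ := hz
    refine cls_some ?_ ?_
    · rcases hya with h | h | h <;> simp [← h, hy]
    · rcases hza with h | h | h <;> simp [← h, hz]
  have nA := fun A hA hcl => cls_neighbor (r := r) (A := A) f hab hac hbc haS hbS hcS ha hb hc h0 hA hcl
  have nB := fun A hA hcl => cls_neighbor (r := r) (A := A) f hab.symm hbc hac hbS haS hcS hb ha hc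
    (fun e h1 h2 h3 h4 => h0 e h1 h3 h2 h4) hA hcl
  have nC := fun A hA hcl => cls_neighbor (r := r) (A := A) f hac.symm hbc.symm hab hcS haS hbS hc ha hb
    (fun e h1 h2 h3 h4 => h0 e h1 h3 h4 h2) hA hcl
  -- abstract combination
  have key : ∀ (C₁ C₂ C₃ : Finset E → Prop),
      (∀ P Q, Valid K w S r P → Valid K w S r Q → C₁ P → C₁ Q → Conn K w S r P Q) →
      (∀ P Q, Valid K w S r P → Valid K w S r Q → C₂ P → C₂ Q → Conn K w S r P Q) →
      (∀ P Q, Valid K w S r P → Valid K w S r Q → C₃ P → C₃ Q → Conn K w S r P Q) →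
      (∀ P, Valid K w S r P → C₁ P → ∃ B, Step K w S r P B ∧ (C₂ B ∨ C₃ B)) →
      (∀ P, Valid K w S r P → C₂ P → ∃ B, Step K w S r P B ∧ (C₁ B ∨ C₃ B)) →
      ∀ P Q, Valid K w S r P → Valid K w S r Q → C₁ P → C₂ Q → Conn K w S r P Q := by
    intro C₁ C₂ C₃ H1 H2 H3 n1 n2 P Q hP hQ p q
    obtain ⟨B, hB, hB' | hB'⟩ := n1 P hP p
    · exact (Relation.ReflTransGen.single hB).trans (H2 _ _ hB.2.1 hQ hB' q)
    obtain ⟨D, hD, hD' | hD'⟩ := n2 Q hQ q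
    · exact (H1 _ _ hP hD.2.1 p hD').trans (.single hD.symm)
    · exact (Relation.ReflTransGen.single hB).trans
        ((H3 _ _ hB.2.1 hD.2.1 hB' hD').trans (.single hD.symm))
  have nA1 : ∀ P, Valid K w S r P → Cls a b c P → ∃ B, Step K w S r P B ∧
      (Cls b a c B ∨ Cls c a b B) := nA
  have nB1 : ∀ P, Valid K w S r P → Cls b a c P → ∃ B, Step K w S r P B ∧
      (Cls a b c B ∨ Cls c a b B) := fun P hP h => by
    obtain ⟨B, h1, h2⟩ := nB P hP h
    exact ⟨B, h1, h2.imp id Cls.comm⟩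
  have nC1 : ∀ P, Valid K w S r P → Cls c a b P → ∃ B, Step K w S r P B ∧
      (Cls a b c B ∨ Cls b a c B) := fun P hP h => by
    obtain ⟨B, h1, h2⟩ := nC P hP h
    exact ⟨B, h1, h2.imp Cls.comm Cls.comm⟩
  have AB := key _ _ _ Ha Hb Hc nA1 nB1
  have AC := key _ _ _ Ha Hc Hb (fun P hP h => by
    obtain ⟨B, h1, h2⟩ := nA1 P hP h; exact ⟨B, h1, h2.symm⟩) nC1
  have BC := key _ _ _ Hb Hc Ha (fun P hP h => by
    obtain ⟨B, h1, h2⟩ := nB1 P hP h; exact ⟨B, h1, h2.symm⟩) (fun P hP h => by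
    obtain ⟨B, h1, h2⟩ := nC1 P hP h; exact ⟨B, h1, h2.symm⟩)
  rcases some P hP with p | p | p <;> rcases some Q hQ with q | q | q
  · exact Ha _ _ hP hQ p q
  · exact AB _ _ hP hQ p q
  · exact AC _ _ hP hQ p q
  · exact Conn.symm (AB _ _ hQ hP q p)
  · exact Hb _ _ hP hQ p q
  · exact BC _ _ hP hQ p q
  · exact Conn.symm (AC _ _ hQ hP q p)
  · exact Conn.symm (BC _ _ hQ hP q p)
  · exact Hc _ _ hP hQ p q

end generic

section graph
set_option linter.unusedSectionVars false
variable {V E : Type*} [Fintype V] [DecidableEq V] [DecidableEq E]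

def vec {V : Type*} [DecidableEq V] (x : V × V) : V → ZMod 2 := Pi.single x.1 1 + Pi.single x.2 1

lemma vec_loop {x : V × V} (h : x.1 = x.2) : vec x = 0 := by
  unfold vec
  rw [h]
  funext p
  exact CharTwo.add_self_eq_zero _

lemma vec_ne_zero {x : V × V} (h : x.1 ≠ x.2) (p : V) : vec x p ≠ 0 ↔ x.1 = p ∨ x.2 = p := by
  unfold vec
  simp only [Pi.add_apply, Pi.single_apply]
  by_cases h1 : p = x.1
  · subst h1; simp [h]
  · by_cases h2 : p = x.2
    · subst h2; simp [h1]
    · simp [h1, h2, Ne.symm h1, Ne.symm h2]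

lemma vec_ne_zero_imp {x : V × V} {p : V} (h : vec x p ≠ 0) : x.1 ≠ x.2 ∧ (x.1 = p ∨ x.2 = p) := by
  have h1 : x.1 ≠ x.2 := fun hh => h (by rw [vec_loop hh]; rfl)
  exact ⟨h1, (vec_ne_zero h1 p).1 h⟩

lemma card_support {x : V × V} (h : x.1 ≠ x.2) :
    (Finset.univ.filter (fun p => vec x p ≠ 0)).card = 2 := by
  have : Finset.univ.filter (fun p => vec x p ≠ 0) = {x.1, x.2} := by
    ext p
    simp only [Finset.mem_filter, Finset.mem_univ, true_and, vec_ne_zero h, Finset.mem_insert,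
      Finset.mem_singleton, eq_comm]
  rw [this, Finset.card_pair h]

/-- double counting -/
lemma degree_sum (ends : E → V × V) (T : Finset E) (hT : ∀ e ∈ T, (ends e).1 ≠ (ends e).2) :
    ∑ p : V, (T.filter (fun e => vec (ends e) p ≠ 0)).card = 2 * T.card := by
  have := Finset.sum_card_bipartiteAbove_eq_sum_card_bipartiteBelow
    (fun (p : V) (e : E) => vec (ends e) p ≠ 0) (s := Finset.univ) (t := T)
  unfold Finset.bipartiteAbove Finset.bipartiteBelow at this
  rw [this, Finset.sum_congr rfl (fun e he => card_support (hT e he))]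
  simp [mul_comm]

lemma ind_forest (ends : E → V × V) {S : Finset E}
    (h : Ind (ZMod 2) (fun e => vec (ends e)) S) : IsForest ends S := by
  intro T hTS hT
  have hI := h.mono hTS
  obtain ⟨e, he⟩ := hT
  set p := (ends e).1 with hp
  classical
  set N : Finset V := (edgeVerts ends T).toFinset with hN
  have hNm : ∀ q, q ∈ N ↔ ∃ e ∈ T, (ends e).1 = q ∨ (ends e).2 = q := by
    intro q; rw [hN, Set.mem_toFinset]; rfl
  have hcard : (edgeVerts ends T).ncard = N.card := Set.ncard_eq_toFinset_card' _
  let W : Submodule (ZMod 2) (V → ZMod 2) :=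
    Submodule.span (ZMod 2) (((N.image (fun q => (Pi.single q 1 : V → ZMod 2)) : Finset _)) : Set _)
  let U : Submodule (ZMod 2) (V → ZMod 2) :=
    Submodule.span (ZMod 2) (Set.range (fun e : (T : Set E) => vec (ends e)))
  have hU : Module.finrank (ZMod 2) U = T.card := by
    have := finrank_span_eq_card (R := ZMod 2) (b := fun e : (T : Set E) => vec (ends e)) hI
    rw [this]; simp
  have hW : Module.finrank (ZMod 2) W ≤ N.card :=
    (finrank_span_finset_le_card _).trans Finset.card_image_le
  have hsingle : ∀ q ∈ N, (Pi.single q 1 : V → ZMod 2) ∈ W := by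
    intro q hq
    exact Submodule.subset_span (by simp only [Finset.coe_image]; exact ⟨q, hq, rfl⟩)
  have hle : U ≤ W := by
    rw [Submodule.span_le]
    rintro _ ⟨⟨e, he⟩, rfl⟩
    have he : e ∈ T := by simpa using he
    exact Submodule.add_mem _ (hsingle _ ((hNm _).2 ⟨e, he, .inl rfl⟩))
      (hsingle _ ((hNm _).2 ⟨e, he, .inr rfl⟩))
  have hlt : U < W := by
    refine lt_of_le_of_ne hle ?_
    intro heq
    have hmem : (Pi.single p 1 : V → ZMod 2) ∈ U := by
      rw [heq]; exact hsingle _ ((hNm _).2 ⟨e, he, .inl rfl⟩)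
    let σ : (V → ZMod 2) →ₗ[ZMod 2] ZMod 2 := ∑ q : V, LinearMap.proj q
    have hσ : ∀ x, σ x = ∑ q : V, x q := by intro x; simp [σ]
    have hker : U ≤ LinearMap.ker σ := by
      rw [Submodule.span_le]
      rintro _ ⟨e, rfl⟩
      simp only [SetLike.mem_coe, LinearMap.mem_ker, hσ, vec, Pi.add_apply,
        Finset.sum_add_distrib]
      simp
      decide
    have := hker hmem
    rw [LinearMap.mem_ker, hσ] at this
    simp at this
  have := Submodule.finrank_lt_finrank_of_lt hlt
  omega

lemma forest_ind (ends : E → V × V) {S : Finset E} (h : IsForest ends S) :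
    Ind (ZMod 2) (fun e => vec (ends e)) S := by
  unfold Ind
  rw [linearIndepOn_finset_iff]
  intro g hg
  by_contra! hcon
  obtain ⟨i, hi, hgi⟩ := hcon
  have hloop : ∀ e ∈ S, (ends e).1 ≠ (ends e).2 := by
    intro e he heq
    have h1 := h {e} (by simpa using he) (by simp)
    have : edgeVerts ends {e} = {(ends e).1} := by
      ext v; simp [edgeVerts, ← heq, eq_comm]
    rw [this] at h1
    simp at h1
  set T := S.filter (fun e => g e ≠ 0) with hT
  have hTS : T ⊆ S := Finset.filter_subset _ _
  have hlt := h T hTS ⟨i, by simp [hT, hi, hgi]⟩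
  have hsum : ∀ p, ∑ e ∈ T, vec (ends e) p = 0 := by
    intro p
    have h1 := congrFun hg p
    rw [Finset.sum_apply, Pi.zero_apply] at h1
    rw [← h1, hT, Finset.sum_filter]
    refine Finset.sum_congr rfl fun e _ => ?_
    have : ∀ z : ZMod 2, z ≠ 0 → z = 1 := by decide
    by_cases hz : g e = 0
    · simp [hz]
    · simp [this _ hz]
  classical
  set N : Finset V := (edgeVerts ends T).toFinset with hN
  have hNm : ∀ q, q ∈ N ↔ ∃ e ∈ T, (ends e).1 = q ∨ (ends e).2 = q := by
    intro q; rw [hN, Set.mem_toFinset]; rfl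
  have hcard : (edgeVerts ends T).ncard = N.card := Set.ncard_eq_toFinset_card' _
  have hdeg := degree_sum ends T (fun e he => hloop e (hTS he))
  have h2 : ∀ p ∈ N, 2 ≤ (T.filter (fun e => vec (ends e) p ≠ 0)).card := by
    intro p hp
    obtain ⟨e, he, hep⟩ := (hNm p).1 hp
    have hne := (vec_ne_zero (hloop e (hTS he)) p).2 hep
    have hpos : 0 < (T.filter (fun e => vec (ends e) p ≠ 0)).card :=
      Finset.card_pos.2 ⟨e, by simp [he, hne]⟩
    by_contra hcon
    have h1 : (T.filter (fun e => vec (ends e) p ≠ 0)).card = 1 := by omega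
    obtain ⟨x, hx⟩ := Finset.card_eq_one.1 h1
    have hs := hsum p
    rw [← Finset.sum_filter_ne_zero, hx, Finset.sum_singleton] at hs
    have : x ∈ T.filter (fun e => vec (ends e) p ≠ 0) := by rw [hx]; simp
    exact (Finset.mem_filter.1 this).2 hs
  have h3 : N.card * 2 ≤ ∑ p ∈ N, (T.filter (fun e => vec (ends e) p ≠ 0)).card :=
    Finset.card_nsmul_le_sum N _ 2 h2
  have h4 : ∑ p ∈ N, (T.filter (fun e => vec (ends e) p ≠ 0)).card ≤
      ∑ p : V, (T.filter (fun e => vec (ends e) p ≠ 0)).card :=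
    Finset.sum_le_sum_of_subset (Finset.subset_univ _)
  omega

lemma ind_noloop (ends : E → V × V) {S : Finset E}
    (h : Ind (ZMod 2) (fun e => vec (ends e)) S) : ∀ e ∈ S, (ends e).1 ≠ (ends e).2 := by
  intro e he heq
  have : Ind (ZMod 2) (fun e => vec (ends e)) ({e} : Finset E) := h.mono (by simpa using he)
  unfold Ind at this
  rw [linearIndepOn_finset_iff] at this
  have := this (fun _ => 1) (by simp [vec_loop heq]) e (by simp)
  simp at this

lemma exists_small (ends : E → V × V) {S : Finset E} {r : ℕ} {A : Finset E}
    (hA : Valid (ZMod 2) (fun e => vec (ends e)) S (r+1) A) :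
    ∃ p, (S.filter (fun e => vec (ends e) p ≠ 0)).Nonempty ∧
      (S.filter (fun e => vec (ends e) p ≠ 0)).card ≤ 3 := by
  obtain ⟨h1, h2, h3, h4, h5⟩ := hA
  have hS : S.card = 2 * (r + 1) := by
    have := Finset.card_sdiff_add_card_eq_card h1
    omega
  have hloop : ∀ e ∈ S, (ends e).1 ≠ (ends e).2 := by
    intro e he
    by_cases heA : e ∈ A
    · exact ind_noloop ends h2 e heA
    · exact ind_noloop ends h3 e (by simp [he, heA])
  have hF := ind_forest ends h2 A subset_rfl (Finset.card_pos.1 (by omega))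
  classical
  set N : Finset V := (edgeVerts ends A).toFinset with hN
  have hNm : ∀ q, q ∈ N ↔ ∃ e ∈ A, (ends e).1 = q ∨ (ends e).2 = q := by
    intro q; rw [hN, Set.mem_toFinset]; rfl
  have hcard : (edgeVerts ends A).ncard = N.card := Set.ncard_eq_toFinset_card' _
  have hdeg := degree_sum ends S hloop
  by_contra! hcon
  have h6 : ∀ p ∈ N, 4 ≤ (S.filter (fun e => vec (ends e) p ≠ 0)).card := by
    intro p hp
    obtain ⟨e, he, hep⟩ := (hNm p).1 hp
    have hne := (vec_ne_zero (hloop e (h1 he)) p).2 hep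
    exact hcon p ⟨e, by simp [h1 he, hne]⟩
  have h7 : N.card * 4 ≤ ∑ p ∈ N, (S.filter (fun e => vec (ends e) p ≠ 0)).card :=
    Finset.card_nsmul_le_sum N _ 4 h6
  have h8 : ∑ p ∈ N, (S.filter (fun e => vec (ends e) p ≠ 0)).card ≤
      ∑ p : V, (S.filter (fun e => vec (ends e) p ≠ 0)).card :=
    Finset.sum_le_sum_of_subset (Finset.subset_univ _)
  omega

/-- the edge joining the two far ends -/
lemma exists_join {x y : V × V} {p : V} (hx : vec x p ≠ 0) (hy : vec y p ≠ 0) :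
    ∃ z : V × V, vec z = vec x + vec y := by
  have two : ∀ f : V → ZMod 2, f + f = 0 := fun f => funext fun p => CharTwo.add_self_eq_zero _
  obtain ⟨-, hx⟩ := vec_ne_zero_imp hx
  obtain ⟨-, hy⟩ := vec_ne_zero_imp hy
  have key : ∀ A B C : V → ZMod 2, B + C = (A + B) + (A + C) := by
    intro A B C
    rw [add_add_add_comm, two, zero_add]
  rcases hx with hx | hx <;> rcases hy with hy | hy
  · refine ⟨(x.2, y.2), ?_⟩
    simp only [vec, hx, hy]; exact key _ _ _
  · refine ⟨(x.2, y.1), ?_⟩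
    simp only [vec, hx, hy]; rw [add_comm (Pi.single y.1 1)]; exact key _ _ _
  · refine ⟨(x.1, y.2), ?_⟩
    simp only [vec, hx, hy]; rw [add_comm (Pi.single x.1 1) (Pi.single p 1)]; exact key _ _ _
  · refine ⟨(x.1, y.1), ?_⟩
    simp only [vec, hx, hy]
    rw [add_comm (Pi.single x.1 1) (Pi.single p 1), add_comm (Pi.single y.1 1)]; exact key _ _ _

theorem main_conn (r : ℕ) : ∀ (ends : E → V × V) (S : Finset E),
    (∀ I ⊆ S, Ind (ZMod 2) (fun e => vec (ends e)) I → I.card ≤ r) → ∀ P Q,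
    Valid (ZMod 2) (fun e => vec (ends e)) S r P → Valid (ZMod 2) (fun e => vec (ends e)) S r Q →
    Conn (ZMod 2) (fun e => vec (ends e)) S r P Q := by
  induction r with
  | zero =>
    intro ends S _ P Q hP hQ
    have h1 : P = ∅ := Finset.card_eq_zero.1 hP.2.2.2.1
    have h2 : Q = ∅ := Finset.card_eq_zero.1 hQ.2.2.2.1
    rw [h1, h2]
  | succ r ih =>
    intro ends S hR P Q hP hQ
    obtain ⟨p, ⟨e₀, he₀⟩, hcard⟩ := exists_small ends hP
    set D := S.filter (fun e => vec (ends e) p ≠ 0) with hD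
    let f : (V → ZMod 2) →ₗ[ZMod 2] ZMod 2 := LinearMap.proj p
    have hf : ∀ x, f x = x p := fun x => rfl
    have hDm : ∀ e, e ∈ D ↔ e ∈ S ∧ f (vec (ends e)) ≠ 0 := by intro e; simp [hD, hf]
    have he₀' := (hDm e₀).1 he₀
    obtain ⟨y, hy, hy'⟩ := hP.meets f hR he₀'.1 he₀'.2
    obtain ⟨z, hz, hz'⟩ := hP.compl.meets f hR he₀'.1 he₀'.2
    have hyz : y ≠ z := by rintro rfl; exact (Finset.mem_sdiff.1 hz).2 hy
    have hyD : y ∈ D := (hDm y).2 ⟨hP.1 hy, hy'⟩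
    have hzD : z ∈ D := (hDm z).2 ⟨(Finset.mem_sdiff.1 hz).1, hz'⟩
    have h2 : 2 ≤ D.card := by
      have := Finset.one_lt_card.2 ⟨y, hyD, z, hzD, hyz⟩
      omega
    have h23 : D.card = 2 ∨ D.card = 3 := by omega
    rcases h23 with h | h
    · obtain ⟨a, b, hab, hDab⟩ := Finset.card_eq_two.1 h
      obtain ⟨haS, ha⟩ := (hDm a).1 (by simp [hDab])
      obtain ⟨hbS, hb⟩ := (hDm b).1 (by simp [hDab])
      refine case_two f hab hR haS hbS ha hb ?_ (ih ends _) P Q hP hQ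
      intro e he h1 h2
      by_contra hne
      have := (hDm e).2 ⟨he, hne⟩
      rw [hDab] at this
      simp [h1, h2] at this
    · obtain ⟨a, b, c, hab, hac, hbc, hDab⟩ := Finset.card_eq_three.1 h
      obtain ⟨haS, ha⟩ := (hDm a).1 (by simp [hDab])
      obtain ⟨hbS, hb⟩ := (hDm b).1 (by simp [hDab])
      obtain ⟨hcS, hc⟩ := (hDm c).1 (by simp [hDab])
      have h0 : ∀ e ∈ S, e ≠ a → e ≠ b → e ≠ c → f (vec (ends e)) = 0 := by
        intro e he h1 h2 h3
        by_contra hne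
        have := (hDm e).2 ⟨he, hne⟩
        rw [hDab] at this
        simp [h1, h2, h3] at this
      have cl : ∀ a b c : E, a ≠ b → a ≠ c → b ≠ c → a ∈ S → b ∈ S → c ∈ S →
          f (vec (ends a)) ≠ 0 → f (vec (ends b)) ≠ 0 → f (vec (ends c)) ≠ 0 →
          (∀ e ∈ S, e ≠ a → e ≠ b → e ≠ c → f (vec (ends e)) = 0) →
          ∀ P Q, Valid (ZMod 2) (fun e => vec (ends e)) S (r+1) P →
            Valid (ZMod 2) (fun e => vec (ends e)) S (r+1) Q →
            Cls a b c P → Cls a b c Q → Conn (ZMod 2) (fun e => vec (ends e)) S (r+1) P Q := by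
        intro a b c hab hac hbc haS hbS hcS ha hb hc h0 P Q hP hQ hPc hQc
        obtain ⟨x, hx⟩ := exists_join hb hc
        refine cls_conn (w' := fun e => vec (Function.update ends b x e)) f hab hac hbc
          haS hbS hcS ha hb hc h0 hR ?_ ?_ ?_ (ih (Function.update ends b x) _) P Q hP hQ hPc hQc
        · intro e he; simp [he]
        · simp [hx]
        · have : ∀ u v : ZMod 2, u ≠ 0 → v ≠ 0 → u + v = 0 := by decide
          rw [map_add]; exact this _ _ hb hc
      exact case_three f hab hac hbc haS hbS hcS ha hb hc h0 hR
        (cl a b c hab hac hbc haS hbS hcS ha hb hc h0)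
        (cl b a c hab.symm hbc hac hbS haS hcS hb ha hc
          (fun e h1 h2 h3 h4 => h0 e h1 h3 h2 h4))
        (cl c a b hac.symm hbc.symm hab hcS haS hbS hc ha hb
          (fun e h1 h2 h3 h4 => h0 e h1 h3 h4 h2)) P Q hP hQ

end graph

/-- **Theorem 5 (single exchange graph is connected).** If `G` is a multigraph with `2r`
edges whose cycle matroid has rank `r`, then the single exchange graph `𝔊(M(G))` is
connected: any two ordered pairs of disjoint bases are joined by a path whose edges join
pairs `(B₁,B₂)`, `(D₁,D₂)` with `|B₁ ∩ D₁| = r - 1`. -/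
theorem single_exchange_graph_connected {V E : Type*} [Fintype V] [Fintype E]
    [DecidableEq V] [DecidableEq E] (ends : E → V × V) (r : ℕ) (hr : 1 ≤ r)
    (hrank : ∀ B : Finset E, IsSpanningForest ends B → B.card = r)
    (hE : Fintype.card E = 2 * r)
    (P Q : Finset E × Finset E) (hP : IsExchVertex ends P) (hQ : IsExchVertex ends Q) :
    Relation.ReflTransGen
      (fun A B => IsExchVertex ends A ∧ IsExchVertex ends B ∧ (A.1 ∩ B.1).card = r - 1)
      P Q := by
  have hiff : ∀ B : Finset E, IsForest ends B ↔ Ind (ZMod 2) (fun e => vec (ends e)) B :=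
    fun B => ⟨forest_ind ends, ind_forest ends⟩
  have hR : ∀ I ⊆ (Finset.univ : Finset E), Ind (ZMod 2) (fun e => vec (ends e)) I →
      I.card ≤ r := by
    intro I _ hI
    classical
    obtain ⟨B, hIB, hB⟩ := Finset.exists_le_maximal
      (Finset.univ.filter (fun B : Finset E => IsForest ends B)) (a := I)
      (by simp [hiff, hI])
    have hsp : IsSpanningForest ends B := by
      refine ⟨by simpa using hB.prop, fun e he hcon => he ?_⟩
      exact hB.le_of_ge (y := insert e B) (by simpa using hcon) (Finset.subset_insert _ _)
        (Finset.mem_insert_self _ _)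
    rw [← hrank B hsp]
    exact Finset.card_le_card hIB
  have up : ∀ P, IsExchVertex ends P →
      Valid (ZMod 2) (fun e => vec (ends e)) Finset.univ r P.1 ∧ P = (P.1, Finset.univ \ P.1) := by
    rintro ⟨A, B⟩ ⟨hA, hB, hd⟩
    have e : B = Finset.univ \ A := by
      apply Finset.eq_of_subset_of_card_le
      · intro z hz
        simp only [Finset.mem_sdiff, Finset.mem_univ, true_and]
        exact fun h => Finset.disjoint_left.1 hd h hz
      · rw [Finset.card_sdiff_of_subset (Finset.subset_univ _), Finset.card_univ, hE, hrank A hA, hrank B hB]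
        omega
    refine ⟨⟨Finset.subset_univ _, (hiff A).1 hA.1, ?_, hrank A hA, ?_⟩, by rw [← e]⟩
    · rw [← e]; exact (hiff B).1 hB.1
    · rw [← e]; exact hrank B hB
  have sp : ∀ A : Finset E, Ind (ZMod 2) (fun e => vec (ends e)) A → A.card = r →
      IsSpanningForest ends A := by
    intro A hA hc
    refine ⟨(hiff A).2 hA, fun e he hcon => ?_⟩
    have := hR _ (Finset.subset_univ _) ((hiff _).1 hcon)
    rw [Finset.card_insert_of_notMem he] at this
    omega
  have down : ∀ A, Valid (ZMod 2) (fun e => vec (ends e)) Finset.univ r A →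
      IsExchVertex ends (A, Finset.univ \ A) := by
    rintro A ⟨-, h2, h3, h4, h5⟩
    exact ⟨sp _ h2 h4, sp _ h3 h5, Finset.disjoint_sdiff⟩
  obtain ⟨hP1, hP2⟩ := up P hP
  obtain ⟨hQ1, hQ2⟩ := up Q hQ
  have hc := main_conn r ends Finset.univ hR P.1 Q.1 hP1 hQ1
  rw [hP2, hQ2]
  refine Relation.ReflTransGen.rec .refl (fun {Y Z} _ hst ih => ih.tail ?_) hc
  refine ⟨down _ hst.1, down _ hst.2.1, ?_⟩
  have := hst.2.2
  simp only
  omega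
end

section
/- Let k ≥ 3 and let G be a graph with kr edges whose cycle matroid M(G) has rank r. Then the k-base graph 𝔊_k(M(G)) is connected. -/
/-- A vertex of the `k`-base graph `𝔊_k(M(G))`: a set of `k` pairwise disjoint bases
(whose union is therefore the whole edge set). -/
def IsKBaseVertex {V E : Type*} [Fintype E] [DecidableEq E] (ends : E → V × V) (k : ℕ)
    (P : Finset (Finset E)) : Prop :=
  P.card = k ∧ (∀ B ∈ P, IsSpanningForest ends B) ∧
    Set.PairwiseDisjoint (P : Set (Finset E)) id ∧ P.biUnion id = Finset.univ

namespace KB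

section matching
variable {E : Type*} [Fintype E] [DecidableEq E]

def shared (f g : E → E) : Finset E := Finset.univ.filter (fun z => f z = g z ∧ f z ≠ z)

lemma shared_lt {f g f1 g1 : E → E} (t : E)
    (h : ∀ z, f z = g z → f z ≠ z → f1 z = f z ∧ g1 z = g z)
    (ht : ¬ (f t = g t ∧ f t ≠ t)) (ht1 : f1 t = g1 t) (ht2 : f1 t ≠ t) :
    (shared f g).card < (shared f1 g1).card := by
  apply Finset.card_lt_card
  rw [Finset.ssubset_iff_of_subset]
  · exact ⟨t, by simpa [shared] using ⟨ht1, ht2⟩, by simpa [shared] using ht⟩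
  · intro z hz
    simp only [shared, Finset.mem_filter, Finset.mem_univ, true_and] at hz ⊢
    obtain ⟨h1, h2⟩ := h z hz.1 hz.2
    rw [h1, h2]; exact hz

variable (F : (E → E) → Prop) (R : (E → E) → (E → E) → Prop) (D : Finset E)

def ExProp : Prop := ∀ f, F f → ∀ x ∈ D, ∀ y, f y ≠ y → x ≠ y → x ≠ f y →
      ∃ f', F f' ∧ R f f' ∧ (∀ z, z ≠ x → z ≠ f x → z ≠ y → z ≠ f y → f' z = f z) ∧
        (f' x = y ∨ f' x = f y)

lemma match_main
    (hrefl : ∀ f, F f → R f f)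
    (inv : ∀ f, F f → ∀ e, f (f e) = e)
    (hD : ∀ f, F f → ∀ e, f e ≠ e → e ∈ D)
    (X : ExProp F R D)
    (f g : E → E) (hf : F f) (hg : F g) (a : E) (ha : f a ≠ a) (hb : g a ≠ a) (hab : f a ≠ g a) :
    ∃ f1 g1, F f1 ∧ F g1 ∧ R f f1 ∧ R g g1 ∧ (shared f g).card < (shared f1 g1).card := by
  have i1 := inv f hf
  have i2 := inv g hg
  obtain ⟨f1, hf1, hR1, ho1, hc1⟩ := X f hf (g a) (hD g hg _ (by rw [i2]; exact hb.symm)) a ha hb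
    (Ne.symm hab)
  obtain ⟨g1, hg1, hR2, ho2, hc2⟩ := X g hg (f a) (hD f hf _ (by rw [i1]; exact ha.symm)) a hb ha hab
  have j1 := inv f1 hf1
  have j2 := inv g1 hg1
  have k1 : ∀ z, f z = g z → f z ≠ z → f1 z = f z := by
    intro z h1 h2
    apply ho1 <;> grind
  have k2 : ∀ z, f z = g z → f z ≠ z → g1 z = g z := by
    intro z h1 h2
    apply ho2 <;> grind
  rcases hc1 with hc1 | hc1
  · exact ⟨f1, g, hf1, hg, hR1, hrefl _ hg, shared_lt a (fun z h1 h2 => ⟨k1 z h1 h2, rfl⟩)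
      (by grind) (by grind) (by grind)⟩
  rcases hc2 with hc2 | hc2
  · exact ⟨f, g1, hf, hg1, hrefl _ hf, hR2, shared_lt a (fun z h1 h2 => ⟨rfl, k2 z h1 h2⟩)
      (by grind) (by grind) (by grind)⟩
  exact ⟨f1, g1, hf1, hg1, hR1, hR2, shared_lt (g a) (fun z h1 h2 => ⟨k1 z h1 h2, k2 z h1 h2⟩)
      (by grind) (by grind) (by grind)⟩

lemma match_step
    (hrefl : ∀ f, F f → R f f)
    (htrans : ∀ f g h, R f g → R g h → R f h)
    (inv : ∀ f, F f → ∀ e, f (f e) = e)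
    (hD : ∀ f, F f → ∀ e, f e ≠ e → e ∈ D)
    (N : ℕ) (hN : ∀ f, F f → (Finset.univ.filter (fun e => f e ≠ e)).card = N)
    (X : ExProp F R D)
    (f g : E → E) (hf : F f) (hg : F g) (hfg : f ≠ g) :
    ∃ f1 g1, F f1 ∧ F g1 ∧ R f f1 ∧ R g g1 ∧ (shared f g).card < (shared f1 g1).card := by
  by_cases h : ∃ a, f a ≠ a ∧ g a ≠ a ∧ f a ≠ g a
  · obtain ⟨a, h1, h2, h3⟩ := h
    exact match_main F R D hrefl inv hD X f g hf hg a h1 h2 h3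
  push Not at h
  have i1 := inv f hf
  have i2 := inv g hg
  -- there is a point moved by g, fixed by f
  have hx : ∃ x, f x = x ∧ g x ≠ x := by
    by_contra hno
    push Not at hno
    have hsub : (Finset.univ.filter (fun e => g e ≠ e)) ⊆ (Finset.univ.filter (fun e => f e ≠ e)) := by
      intro z hz
      simp only [Finset.mem_filter, Finset.mem_univ, true_and] at hz ⊢
      exact fun h => hz (hno z h)
    have heq := Finset.eq_of_subset_of_card_le hsub (by rw [hN f hf, hN g hg])
    apply hfg
    funext z
    by_cases hz : f z = z
    · rw [hz, hno z hz]
    · have : z ∈ (Finset.univ.filter (fun e => g e ≠ e)) := by rw [heq]; simpa using hz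
      simp only [Finset.mem_filter, Finset.mem_univ, true_and] at this
      exact h z hz this
  obtain ⟨x, hx1, hx2⟩ := hx
  have hy : ∃ y, f y ≠ y ∧ g y = y := by
    by_contra hno
    push Not at hno
    have hsub : (Finset.univ.filter (fun e => f e ≠ e)) ⊆ (Finset.univ.filter (fun e => g e ≠ e)) := by
      intro z hz
      simp only [Finset.mem_filter, Finset.mem_univ, true_and] at hz ⊢
      exact hno z hz
    have heq := Finset.eq_of_subset_of_card_le hsub (by rw [hN f hf, hN g hg])
    have : x ∈ (Finset.univ.filter (fun e => f e ≠ e)) := by rw [heq]; simpa using hx2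
    simp only [Finset.mem_filter, Finset.mem_univ, true_and] at this
    exact this hx1
  obtain ⟨y, hy1, hy2⟩ := hy
  obtain ⟨f1, hf1, hR1, ho1, hc1⟩ := X f hf x (hD g hg _ hx2) y hy1 (by grind) (by grind)
  have k1 : ∀ z, f z = g z → f z ≠ z → f1 z = f z := by
    intro z h1 h2
    apply ho1 <;> grind
  have hle : (shared f g).card ≤ (shared f1 g).card := by
    apply Finset.card_le_card
    intro z hz
    simp only [shared, Finset.mem_filter, Finset.mem_univ, true_and] at hz ⊢
    rw [k1 z hz.1 hz.2]; exact hz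
  obtain ⟨f2, g2, hf2, hg2, hr1, hr2, hlt⟩ := match_main F R D hrefl inv hD X f1 g hf1 hg x
    (by grind) hx2 (by grind)
  exact ⟨f2, g2, hf2, hg2, htrans _ _ _ hR1 hr1, hr2, lt_of_le_of_lt hle hlt⟩

lemma match_conn
    (hrefl : ∀ f, F f → R f f)
    (hsymm : ∀ f g, R f g → R g f)
    (htrans : ∀ f g h, R f g → R g h → R f h)
    (inv : ∀ f, F f → ∀ e, f (f e) = e)
    (hD : ∀ f, F f → ∀ e, f e ≠ e → e ∈ D)
    (N : ℕ) (hN : ∀ f, F f → (Finset.univ.filter (fun e => f e ≠ e)).card = N)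
    (X : ExProp F R D) :
    ∀ f g : E → E, F f → F g → R f g := by
  have key : ∀ n : ℕ, ∀ f g : E → E, F f → F g → Fintype.card E ≤ n + (shared f g).card →
      R f g := by
    intro n
    induction n with
    | zero =>
      intro f g hf hg hn
      by_cases hfg : f = g
      · subst hfg; exact hrefl _ hf
      obtain ⟨f1, g1, -, -, -, -, hlt⟩ := match_step F R D hrefl htrans inv hD N hN X f g hf hg hfg
      have := Finset.card_le_univ (shared f1 g1)
      omega
    | succ n ih =>
      intro f g hf hg hn
      by_cases hfg : f = g
      · subst hfg; exact hrefl _ hf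
      obtain ⟨f1, g1, hf1, hg1, hr1, hr2, hlt⟩ :=
        match_step F R D hrefl htrans inv hD N hN X f g hf hg hfg
      exact htrans _ _ _ hr1 (htrans _ _ _ (ih f1 g1 hf1 hg1 (by omega)) (hsymm _ _ hr2))
  intro f g hf hg
  exact key (Fintype.card E) f g hf hg (by omega)

end matching
end KB

namespace KB
set_option linter.unusedSectionVars false
set_option linter.unusedVariables false
open Module Submodule

section linear
variable {V E : Type*} [Fintype V] [Fintype E] [DecidableEq V] [DecidableEq E] {k : ℕ}

def cls (A : Finset E) (c : E → Fin k) (i : Fin k) : Finset E := A.filter (fun e => c e = i)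

lemma mem_cls {A : Finset E} {c : E → Fin k} {i : Fin k} {e : E} :
    e ∈ cls A c i ↔ e ∈ A ∧ c e = i := by simp [cls]

def Good (x : E → V → ℚ) (A : Finset E) (c : E → Fin k) : Prop :=
  ∀ i, LinearIndepOn ℚ x (cls A c i : Set E)

def Step (x : E → V → ℚ) (A : Finset E) (c c' : E → Fin k) : Prop :=
  Good x A c ∧ Good x A c' ∧ ∃ i, ∀ e ∈ A, (c e = i ↔ c' e = i)

def Conn (x : E → V → ℚ) (A : Finset E) : (E → Fin k) → (E → Fin k) → Prop :=
  Relation.ReflTransGen (Step x A)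

lemma Step.symm {x : E → V → ℚ} {A : Finset E} {c c' : E → Fin k} (h : Step x A c c') :
    Step x A c' c := by
  obtain ⟨h1, h2, i, hi⟩ := h
  exact ⟨h2, h1, i, fun e he => (hi e he).symm⟩

lemma Conn.symm {x : E → V → ℚ} {A : Finset E} {c c' : E → Fin k} (h : Conn x A c c') :
    Conn x A c' c := by
  unfold Conn at *
  induction h with
  | refl => exact Relation.ReflTransGen.refl
  | tail _ h2 ih => exact Relation.ReflTransGen.head h2.symm ih

lemma Conn.trans {x : E → V → ℚ} {A : Finset E} {c c' c'' : E → Fin k} (h : Conn x A c c')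
    (h' : Conn x A c' c'') : Conn x A c c'' := Relation.ReflTransGen.trans h h'

lemma Conn.refl {x : E → V → ℚ} {A : Finset E} (c : E → Fin k) : Conn x A c c :=
  Relation.ReflTransGen.refl

lemma Step.conn {x : E → V → ℚ} {A : Finset E} {c c' : E → Fin k} (h : Step x A c c') :
    Conn x A c c' := Relation.ReflTransGen.single h

def Graphic (x : E → V → ℚ) (A : Finset E) : Prop :=
  ∀ e ∈ A, ∃ u w : V, x e = Pi.single u 1 - Pi.single w 1

structure Ctx (x : E → V → ℚ) (A : Finset E) (W : Submodule ℚ (V → ℚ)) (k : ℕ) : Prop where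
  mem : ∀ e ∈ A, x e ∈ W
  card : k * finrank ℚ W ≤ A.card

lemma span_le_W {x : E → V → ℚ} {A : Finset E} {W : Submodule ℚ (V → ℚ)}
    (hm : ∀ e ∈ A, x e ∈ W) {T : Finset E} (hT : T ⊆ A) : span ℚ (x '' (T : Set E)) ≤ W := by
  rw [span_le]
  rintro _ ⟨e, he, rfl⟩
  exact hm e (hT he)

lemma finrank_span_indep {x : E → V → ℚ} {T : Finset E} (h : LinearIndepOn ℚ x (T : Set E)) :
    finrank ℚ (span ℚ (x '' (T : Set E))) = T.card := by
  have h2 : LinearIndependent ℚ (fun e : T => x e) := h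
  have := finrank_span_eq_card h2
  rw [Fintype.card_coe] at this
  rw [← this, Set.image_eq_range]
  rfl

lemma card_le_of_indep {x : E → V → ℚ} {T : Finset E} {W : Submodule ℚ (V → ℚ)}
    (h : LinearIndepOn ℚ x (T : Set E)) (hm : ∀ e ∈ T, x e ∈ W) : T.card ≤ finrank ℚ W := by
  rw [← finrank_span_indep h]
  exact Submodule.finrank_mono (span_le_W hm subset_rfl)

lemma span_eq_of_card {x : E → V → ℚ} {T : Finset E} {W : Submodule ℚ (V → ℚ)}
    (h : LinearIndepOn ℚ x (T : Set E)) (hm : ∀ e ∈ T, x e ∈ W) (hc : T.card = finrank ℚ W) :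
    span ℚ (x '' (T : Set E)) = W := by
  apply Submodule.eq_of_le_of_finrank_eq (span_le_W hm subset_rfl)
  rw [finrank_span_indep h, hc]

lemma cls_subset (A : Finset E) (c : E → Fin k) (i : Fin k) : cls A c i ⊆ A :=
  Finset.filter_subset _ _

lemma sum_card_cls (A : Finset E) (c : E → Fin k) : ∑ i, (cls A c i).card = A.card :=
  (Finset.card_eq_sum_card_fiberwise (f := c) (t := Finset.univ) (by simp)).symm

lemma Ctx.card_cls {x : E → V → ℚ} {A : Finset E} {W : Submodule ℚ (V → ℚ)}
    (C : Ctx x A W k) {c : E → Fin k} (hc : Good x A c) (i : Fin k) :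
    (cls A c i).card = finrank ℚ W := by
  have h1 : ∀ i ∈ (Finset.univ : Finset (Fin k)), (cls A c i).card ≤ finrank ℚ W := fun i _ =>
    card_le_of_indep (hc i) (fun e he => C.mem e (cls_subset _ _ _ he))
  have h2 : ∑ i : Fin k, (cls A c i).card = ∑ i : Fin k, finrank ℚ W := by
    apply le_antisymm (Finset.sum_le_sum h1)
    rw [sum_card_cls]
    simpa using C.card
  exact (Finset.sum_eq_sum_iff_of_le h1).1 h2 i (Finset.mem_univ _)

lemma Ctx.span_cls {x : E → V → ℚ} {A : Finset E} {W : Submodule ℚ (V → ℚ)}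
    (C : Ctx x A W k) {c : E → Fin k} (hc : Good x A c) (i : Fin k) :
    span ℚ (x '' (cls A c i : Set E)) = W :=
  span_eq_of_card (hc i) (fun e he => C.mem e (cls_subset _ _ _ he)) (C.card_cls hc i)

lemma Ctx.card_eq {x : E → V → ℚ} {A : Finset E} {W : Submodule ℚ (V → ℚ)}
    (C : Ctx x A W k) {c : E → Fin k} (hc : Good x A c) :
    A.card = k * finrank ℚ W := by
  rw [← sum_card_cls A c, Finset.sum_congr rfl (fun i _ => C.card_cls hc i)]
  simp

/-- dual functional of an element of an independent set -/
lemma exists_dual {x : E → V → ℚ} {T : Finset E} (h : LinearIndepOn ℚ x (T : Set E))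
    {e : E} (he : e ∈ T) :
    ∃ p : (V → ℚ) →ₗ[ℚ] ℚ, p (x e) = 1 ∧ ∀ t ∈ T, t ≠ e → p (x t) = 0 := by
  have hn : x e ∉ span ℚ (x '' ((T : Set E) \ {e})) := h.notMem_span he
  obtain ⟨f, hf, hle⟩ := Submodule.exists_le_ker_of_notMem hn
  refine ⟨(f (x e))⁻¹ • f, by simp [hf], fun t ht hte => ?_⟩
  have : x t ∈ LinearMap.ker f := hle (subset_span ⟨t, ⟨ht, by simpa using hte⟩, rfl⟩)
  simp [LinearMap.mem_ker.1 this]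

lemma notMem_span_of_dual {x : E → V → ℚ} {T : Set E} (p : (V → ℚ) →ₗ[ℚ] ℚ)
    (h : ∀ t ∈ T, p (x t) = 0) {w : V → ℚ} (hw : p w ≠ 0) : w ∉ span ℚ (x '' T) := by
  intro hmem
  have : span ℚ (x '' T) ≤ LinearMap.ker p := by
    rw [span_le]; rintro _ ⟨t, ht, rfl⟩; exact h t ht
  exact hw (this hmem)

lemma exchange {x : E → V → ℚ} {T : Finset E} (h : LinearIndepOn ℚ x (T : Set E))
    {w : V → ℚ} (hw : w ∈ span ℚ (x '' (T : Set E))) (p : (V → ℚ) →ₗ[ℚ] ℚ) (hp : p w ≠ 0) :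
    ∃ g ∈ T, p (x g) ≠ 0 ∧ w ∉ span ℚ (x '' ((T : Set E) \ {g})) := by
  obtain ⟨a, ha⟩ : ∃ a : E → ℚ, ∑ t ∈ T, a t • x t = w := by
    rw [Submodule.mem_span_image_finset_iff_exists_fun] at hw
    obtain ⟨a, ha⟩ := hw
    refine ⟨fun t => if h : t ∈ T then a ⟨t, h⟩ else 0, ?_⟩
    rw [← ha, ← Finset.sum_coe_sort]
    simp
  have h1 : ∃ g ∈ T, a g * p (x g) ≠ 0 := by
    by_contra hno
    push Not at hno
    apply hp
    rw [← ha, map_sum]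
    apply Finset.sum_eq_zero
    intro g hg
    rw [map_smul, smul_eq_mul, hno g hg]
  obtain ⟨g, hg, hne⟩ := h1
  refine ⟨g, hg, right_ne_zero_of_mul hne, fun hmem => ?_⟩
  obtain ⟨q, hq1, hq2⟩ := exists_dual h hg
  refine notMem_span_of_dual q (T := (T : Set E) \ {g}) (w := w) ?_ ?_ hmem
  · intro t ht; exact hq2 t ht.1 (by simpa using ht.2)
  · rw [← ha, map_sum, Finset.sum_eq_single g]
    · rw [map_smul, hq1]; simpa using left_ne_zero_of_mul hne
    · intro t ht htg; rw [map_smul, hq2 t ht htg, smul_zero]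
    · intro h; exact absurd hg h

def swapc (c : E → Fin k) (e g : E) : E → Fin k :=
  fun t => if t = e then c g else if t = g then c e else c t

lemma swap_good {x : E → V → ℚ} {A : Finset E} {c : E → Fin k} (hc : Good x A c)
    {e g : E} (he : e ∈ A) (hg : g ∈ A) (hij : c e ≠ c g)
    (h1 : x g ∉ span ℚ (x '' ((cls A c (c e) : Set E) \ {e})))
    (h2 : x e ∉ span ℚ (x '' ((cls A c (c g) : Set E) \ {g}))) : Good x A (swapc c e g) := by
  intro l
  have hne : e ≠ g := fun h => hij (by rw [h])
  by_cases hl : l = c e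
  · subst hl
    have := ((hc (c e)).mono (Set.sdiff_subset (t := {e}))).insert h1
    refine this.mono ?_
    intro t ht
    simp only [Finset.mem_coe, mem_cls, swapc] at ht
    simp only [Set.mem_insert_iff, Set.mem_sdiff, Finset.mem_coe, mem_cls, Set.mem_singleton_iff]
    grind
  by_cases hl2 : l = c g
  · subst hl2
    have := ((hc (c g)).mono (Set.sdiff_subset (t := {g}))).insert h2
    refine this.mono ?_
    intro t ht
    simp only [Finset.mem_coe, mem_cls, swapc] at ht
    simp only [Set.mem_insert_iff, Set.mem_sdiff, Finset.mem_coe, mem_cls, Set.mem_singleton_iff]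
    grind
  refine (hc l).mono ?_
  intro t ht
  simp only [Finset.mem_coe, mem_cls, swapc] at ht ⊢
  grind

lemma exists_third (hk : 3 ≤ k) (i j : Fin k) : ∃ l, l ≠ i ∧ l ≠ j := by
  have : ∃ l ∈ (Finset.univ : Finset (Fin k)), l ∉ ({i, j} : Finset (Fin k)) := by
    apply Finset.exists_mem_notMem_of_card_lt_card
    have := Finset.card_le_two (a := i) (b := j)
    simp; omega
  obtain ⟨l, -, hl⟩ := this
  simp at hl
  exact ⟨l, hl.1, hl.2⟩

lemma swap_step (hk : 3 ≤ k) {x : E → V → ℚ} {A : Finset E} {c : E → Fin k} (hc : Good x A c)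
    {e g : E} (hgood : Good x A (swapc c e g)) : Step x A c (swapc c e g) := by
  obtain ⟨l, h1, h2⟩ := exists_third hk (c e) (c g)
  refine ⟨hc, hgood, l, fun t _ => ?_⟩
  unfold swapc
  grind

end linear
end KB

namespace KB
set_option linter.unusedSectionVars false
set_option linter.unusedVariables false
open Module Submodule

section graph
variable {V E : Type*} [Fintype V] [Fintype E] [DecidableEq V] [DecidableEq E] {k : ℕ}

def Dv (x : E → V → ℚ) (A : Finset E) (v : V) : Finset E := A.filter (fun e => x e v = 1)

lemma mem_Dv {x : E → V → ℚ} {A : Finset E} {v : V} {e : E} :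
    e ∈ Dv x A v ↔ e ∈ A ∧ x e v = 1 := by simp [Dv]

lemma eq_of_apply_one {y : V → ℚ} {u w v : V} (h : y = Pi.single u 1 - Pi.single w 1)
    (h1 : y v = 1) : u = v ∧ w ≠ v := by
  subst h
  simp only [Pi.sub_apply, Pi.single_apply] at h1
  split_ifs at h1 <;> first | (norm_num at h1; done) | (refine ⟨?_, ?_⟩ <;> grind)

lemma dual_cases {x : E → V → ℚ} {A : Finset E} {W : Submodule ℚ (V → ℚ)} {v : V}
    (hG : Graphic x A) (hm : ∀ e ∈ A, x e ∈ W) {T : Finset E} (hT : T ⊆ A)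
    (hs : span ℚ (x '' (T : Set E)) = W) {e e' f : E} (he : e ∈ T) (he' : e' ∈ T) (hne : e ≠ e')
    (hev : x e v = 1) (hev' : x e' v = 1) (hf : f ∈ A) (hfv : x f v = 1)
    {p p' : (V → ℚ) →ₗ[ℚ] ℚ} (hp : ∀ t ∈ T, t ≠ e → p (x t) = 0)
    (hp' : ∀ t ∈ T, t ≠ e' → p' (x t) = 0) : p (x f) = 0 ∨ p' (x f) = 0 := by
  set Q : V → ℚ := fun u => (p (Pi.single u 1) - p (Pi.single v 1)) *
    (p' (Pi.single u 1) - p' (Pi.single v 1)) with hQ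
  set q : (V → ℚ) →ₗ[ℚ] ℚ := ∑ u, (Q u) • LinearMap.proj u with hq
  have hq1 : ∀ u, q (Pi.single u 1) = Q u := by
    intro u
    simp [hq, Pi.single_apply]
  have hker : ∀ y ∈ W, q y = 0 := by
    intro y hy
    rw [← hs] at hy
    have : span ℚ (x '' (T : Set E)) ≤ LinearMap.ker q := by
      rw [span_le]
      rintro _ ⟨t, ht, rfl⟩
      obtain ⟨u, w, huw⟩ := hG t (hT ht)
      show q (x t) = 0
      rw [huw, map_sub, hq1, hq1]
      by_cases h1 : t = e
      · subst h1
        obtain ⟨rfl, -⟩ := eq_of_apply_one huw hev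
        have := hp' t ht hne
        rw [huw, map_sub] at this
        have h2 : p' (Pi.single w 1) = p' (Pi.single u 1) := by linarith
        simp [hQ, h2]
      by_cases h2 : t = e'
      · subst h2
        obtain ⟨rfl, -⟩ := eq_of_apply_one huw hev'
        have := hp t ht hne.symm
        rw [huw, map_sub] at this
        have h2 : p (Pi.single w 1) = p (Pi.single u 1) := by linarith
        simp [hQ, h2]
      have a1 := hp t ht h1
      have a2 := hp' t ht h2
      rw [huw, map_sub] at a1 a2
      have b1 : p (Pi.single w 1) = p (Pi.single u 1) := by linarith
      have b2 : p' (Pi.single w 1) = p' (Pi.single u 1) := by linarith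
      simp [hQ, b1, b2]
    exact this hy
  have h0 := hker _ (hm f hf)
  obtain ⟨u, w, huw⟩ := hG f hf
  obtain ⟨rfl, -⟩ := eq_of_apply_one huw hfv
  rw [huw, map_sub, hq1, hq1] at h0
  simp only [hQ, sub_self, mul_zero, zero_sub, neg_eq_zero, mul_eq_zero] at h0
  rw [huw, map_sub, map_sub]
  rcases h0 with h | h
  · left; linarith
  · right; linarith

variable {x : E → V → ℚ} {A : Finset E} {W : Submodule ℚ (V → ℚ)} {v : V}

lemma swap_one (C : Ctx x A W k) {c : E → Fin k} (hc : Good x A c) {e f : E}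
    (he : e ∈ A) (hf : f ∈ A) (hij : c e ≠ c f)
    (p : (V → ℚ) →ₗ[ℚ] ℚ) (hp1 : p (x e) = 1) (hp : ∀ t ∈ cls A c (c e), t ≠ e → p (x t) = 0)
    (hpf : p (x f) = 0) :
    ∃ g ∈ A, g ≠ f ∧ c g = c f ∧ Good x A (swapc c e g) := by
  have hw : x e - x f ∈ span ℚ (x '' (cls A c (c f) : Set E)) := by
    rw [C.span_cls hc]
    exact W.sub_mem (C.mem _ he) (C.mem _ hf)
  obtain ⟨g, hg, hpg, hn⟩ := exchange (hc (c f)) hw p (by rw [map_sub, hp1, hpf]; norm_num)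
  rw [mem_cls] at hg
  have hgf : g ≠ f := by rintro rfl; exact hpg hpf
  refine ⟨g, hg.1, hgf, hg.2, swap_good hc he hg.1 (by rw [hg.2]; exact hij) ?_ ?_⟩
  · apply notMem_span_of_dual p _ hpg
    rintro t ⟨ht, hte⟩
    exact hp t ht (by simpa using hte)
  · rw [hg.2]
    intro hmem
    apply hn
    refine sub_mem hmem (subset_span ⟨f, ⟨?_, ?_⟩, rfl⟩)
    · simp [mem_cls, hf]
    · simpa using hgf.symm

/-- moving one of two elements at `v` from one class to a class with a single element at `v` -/
lemma swap_down (C : Ctx x A W k) (hG : Graphic x A) {c : E → Fin k} (hc : Good x A c)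
    {e e' f : E} (he : e ∈ Dv x A v) (he' : e' ∈ Dv x A v) (hne : e ≠ e') (hee : c e = c e')
    (hf : f ∈ Dv x A v) (hij : c e ≠ c f) (huniq : ∀ t ∈ Dv x A v, c t = c f → t = f) :
    ∃ e0, (e0 = e ∨ e0 = e') ∧ ∃ g ∈ A, g ∉ Dv x A v ∧ c g = c f ∧ Good x A (swapc c e0 g) := by
  rw [mem_Dv] at he he' hf
  have m1 : e ∈ cls A c (c e) := mem_cls.2 ⟨he.1, rfl⟩
  have m2 : e' ∈ cls A c (c e) := mem_cls.2 ⟨he'.1, hee.symm⟩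
  obtain ⟨p, hp1, hp⟩ := exists_dual (hc (c e)) m1
  obtain ⟨p', hp1', hp'⟩ := exists_dual (hc (c e)) m2
  rcases dual_cases hG C.mem (cls_subset A c (c e)) (C.span_cls hc (c e)) m1 m2 hne he.2 he'.2
    hf.1 hf.2 hp hp' with h | h
  · obtain ⟨g, h1, h2, h3, h4⟩ := swap_one C hc he.1 hf.1 hij p hp1 hp h
    exact ⟨e, Or.inl rfl, g, h1, fun hD => h2 (huniq g hD h3), h3, h4⟩
  · rw [hee] at hp'
    obtain ⟨g, h1, h2, h3, h4⟩ := swap_one C hc he'.1 hf.1 (hee ▸ hij) p' hp1' hp' h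
    exact ⟨e', Or.inr rfl, g, h1, fun hD => h2 (huniq g hD h3), h3, h4⟩

lemma exch1 (hk : 3 ≤ k) (C : Ctx x A W k) (hG : Graphic x A) {c : E → Fin k} (hc : Good x A c)
    {e e' f : E} (he : e ∈ Dv x A v) (he' : e' ∈ Dv x A v) (hne : e ≠ e') (hee : c e = c e')
    (hf : f ∈ Dv x A v) (hij : c e ≠ c f) (huniq : ∀ t ∈ Dv x A v, c t = c f → t = f) :
    ∃ c', Good x A c' ∧ Conn x A c c' ∧ ∃ e0, (e0 = e ∨ e0 = e') ∧
      ∀ t ∈ Dv x A v, c' t = if t = e0 then c f else c t := by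
  obtain ⟨e0, h0, g, hgA, hgD, hgc, hg⟩ := swap_down C hG hc he he' hne hee hf hij huniq
  refine ⟨_, hg, (swap_step hk hc hg).conn, e0, h0, ?_⟩
  intro t ht
  have : t ≠ g := by rintro rfl; exact hgD ht
  simp [swapc, this, hgc]

lemma exch2 (hk : 3 ≤ k) (C : Ctx x A W k) (hG : Graphic x A) {c : E → Fin k} (hc : Good x A c)
    {a b y z : E} (ha : a ∈ Dv x A v) (hb : b ∈ Dv x A v) (hy : y ∈ Dv x A v) (hz : z ∈ Dv x A v)
    (hab : a ≠ b) (hyz : y ≠ z) (cab : c a = c b) (cyz : c y = c z) (cay : c a ≠ c y)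
    (hu1 : ∀ t ∈ Dv x A v, c t = c a → t = a ∨ t = b)
    (hu2 : ∀ t ∈ Dv x A v, c t = c y → t = y ∨ t = z) :
    ∃ c', Good x A c' ∧ Conn x A c c' ∧ ∃ w, (w = y ∨ w = z) ∧
      ∀ t ∈ Dv x A v, c' t = swapc c a w t := by
  have haA := (mem_Dv.1 ha).1
  have m1 : a ∈ cls A c (c a) := mem_cls.2 ⟨haA, rfl⟩
  obtain ⟨p, hp1, hp⟩ := exists_dual (hc (c a)) m1
  have hw : x a ∈ span ℚ (x '' (cls A c (c y) : Set E)) := by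
    rw [C.span_cls hc]
    exact C.mem _ haA
  obtain ⟨g, hg, hpg, hn⟩ := exchange (hc (c y)) hw p (by rw [hp1]; norm_num)
  rw [mem_cls] at hg
  have hgood : Good x A (swapc c a g) := by
    refine swap_good hc haA hg.1 (by rw [hg.2]; exact cay) ?_ (by rw [hg.2]; exact hn)
    apply notMem_span_of_dual p _ hpg
    rintro t ⟨ht, hte⟩
    exact hp t ht (by simpa using hte)
  have hconn := (swap_step hk hc hgood).conn
  by_cases hgD : g ∈ Dv x A v
  · exact ⟨_, hgood, hconn, g, hu2 g hgD hg.2, fun t _ => rfl⟩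
  -- now class of y has three elements a, y, z
  have hD : ∀ t ∈ Dv x A v, swapc c a g t = if t = a then c y else c t := by
    intro t ht
    have : t ≠ g := by rintro rfl; exact hgD ht
    simp [swapc, this, hg.2]
  obtain ⟨c', h1, h2, w, hw, h3⟩ := exch1 (v := v) hk C hG hgood hy hz hyz
    (by rw [hD y hy, hD z hz]; grind) hb (by rw [hD y hy, hD b hb]; grind)
    (by
      intro t ht
      rw [hD t ht, hD b hb]
      intro h
      rcases hu1 t ht (by grind) with h | h <;> grind)
  refine ⟨c', h1, hconn.trans h2, w, hw, fun t ht => ?_⟩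
  rw [h3 t ht, hD t ht, hD b hb]
  unfold swapc
  grind

end graph
end KB

namespace KB
set_option linter.unusedSectionVars false
set_option linter.unusedVariables false
open Module Submodule

section pairs
variable {V E : Type*} [Fintype V] [Fintype E] [DecidableEq V] [DecidableEq E] {k : ℕ}

def Small (D : Finset E) (c : E → Fin k) : Prop :=
  ∀ a ∈ D, ∀ b ∈ D, ∀ z ∈ D, c a = c b → c b = c z → a = b ∨ b = z ∨ a = z

structure Pairs (D : Finset E) (c : E → Fin k) (f : E → E) : Prop where
  inv : ∀ e, f (f e) = e
  off : ∀ e, e ∉ D → f e = e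
  mem : ∀ e ∈ D, f e ∈ D
  iff : ∀ e ∈ D, ∀ e' ∈ D, (c e' = c e ↔ e' = e ∨ e' = f e)

lemma exists_pairs {D : Finset E} {c : E → Fin k} (h : Small D c) : ∃ f, Pairs D c f := by
  classical
  have : ∀ e : E, ∃ e' : E, (e ∉ D → e' = e) ∧ (e ∈ D → e' ∈ D ∧ c e' = c e ∧
      (e' = e → ∀ t ∈ D, c t = c e → t = e)) := by
    intro e
    by_cases he : e ∈ D
    · by_cases h2 : ∃ e' ∈ D, e' ≠ e ∧ c e' = c e
      · obtain ⟨e', h1, h2, h3⟩ := h2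
        exact ⟨e', fun h => absurd he h, fun _ => ⟨h1, h3, fun h => absurd h h2⟩⟩
      · push Not at h2
        refine ⟨e, fun _ => rfl, fun _ => ⟨he, rfl, fun _ t ht htc => ?_⟩⟩
        by_contra hne
        exact h2 t ht hne htc
    · exact ⟨e, fun _ => rfl, fun h => absurd h he⟩
  choose f hf1 hf2 using this
  refine ⟨f, ?_, hf1, fun e he => (hf2 e he).1, ?_⟩
  · intro e
    by_cases he : e ∈ D
    · obtain ⟨h1, h2, h3⟩ := hf2 e he
      obtain ⟨h4, h5, h6⟩ := hf2 (f e) h1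
      have := h e he (f e) h1 (f (f e)) h4 (by grind) (by grind)
      grind
    · rw [hf1 e he, hf1 e he]
  · intro e he e' he'
    obtain ⟨h1, h2, h3⟩ := hf2 e he
    constructor
    · intro h4
      have := h e he (f e) h1 e' he' (by grind) (by grind)
      grind
    · rintro (rfl | rfl)
      · rfl
      · exact h2

lemma Pairs.small {D : Finset E} {c : E → Fin k} {f : E → E} (h : Pairs D c f) : Small D c := by
  intro a ha b hb z hz h1 h2
  have := (h.iff b hb a ha).1 h1
  have := (h.iff b hb z hz).1 h2.symm
  grind

lemma Pairs.count {D : Finset E} {c : E → Fin k} {f : E → E} (h : Pairs D c f)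
    (hne : ∀ i, ∃ e ∈ D, c e = i) :
    (Finset.univ.filter (fun e => f e ≠ e)).card = 2 * D.card - 2 * k := by
  have h1 : ∑ e ∈ D, (if f e ≠ e then 1 else 2) = 2 * k := by
    rw [← Finset.sum_fiberwise D c]
    have : ∀ i ∈ (Finset.univ : Finset (Fin k)),
        ∑ e ∈ D with c e = i, (if f e ≠ e then 1 else 2) = 2 := by
      intro i _
      obtain ⟨e, he, rfl⟩ := hne i
      have hset : D.filter (fun t => c t = c e) = {e, f e} := by
        ext t
        simp only [Finset.mem_filter, Finset.mem_insert, Finset.mem_singleton]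
        constructor
        · rintro ⟨h1, h2⟩; exact (h.iff e he t h1).1 h2
        · intro ht
          have htD : t ∈ D := by
            rcases ht with rfl | rfl
            · exact he
            · exact h.mem e he
          exact ⟨htD, (h.iff e he t htD).2 ht⟩
      rw [hset]
      by_cases hfe : f e = e
      · simp [hfe]
      · rw [Finset.sum_pair (Ne.symm hfe), if_pos hfe, if_pos (by rw [h.inv]; exact Ne.symm hfe)]
    rw [Finset.sum_congr rfl this]
    simp [mul_comm]
  have h2 : (Finset.univ.filter (fun e => f e ≠ e)) = D.filter (fun e => f e ≠ e) := by
    ext e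
    simp only [Finset.mem_filter, Finset.mem_univ, true_and]
    constructor
    · intro he
      refine ⟨?_, he⟩
      by_contra hD
      exact he (h.off e hD)
    · exact fun h => h.2
  rw [h2]
  have h3 := Finset.card_filter_add_card_filter_not (s := D) (fun e => f e ≠ e)
  rw [Finset.sum_ite] at h1
  simp only [Finset.sum_const, smul_eq_mul] at h1
  omega

variable {x : E → V → ℚ} {A : Finset E} {W : Submodule ℚ (V → ℚ)} {v : V}

lemma reduce (hk : 3 ≤ k) (C : Ctx x A W k) (hG : Graphic x A)
    (hne : ∀ c : E → Fin k, Good x A c → ∀ i, ∃ e ∈ Dv x A v, c e = i)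
    (hd : (Dv x A v).card < 2 * k) :
    ∀ n : ℕ, ∀ c : E → Fin k, Good x A c →
      (Finset.univ.filter (fun j : Fin k => ∃ f ∈ Dv x A v, c f = j ∧
        ∀ t ∈ Dv x A v, c t = j → t = f)).card ≤ n →
      ∃ c', Good x A c' ∧ Conn x A c c' ∧ Small (Dv x A v) c' := by
  intro n
  have hex : ∀ c : E → Fin k, Good x A c → ∃ f ∈ Dv x A v, ∀ t ∈ Dv x A v, c t = c f → t = f := by
    intro c hc
    by_contra hno
    push Not at hno
    have : ∑ i : Fin k, ((Dv x A v).filter (fun e => c e = i)).card = (Dv x A v).card :=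
      (Finset.card_eq_sum_card_fiberwise (f := c) (t := Finset.univ) (by simp)).symm
    have h2 : ∑ i : Fin k, 2 ≤ ∑ i : Fin k, ((Dv x A v).filter (fun e => c e = i)).card := by
      apply Finset.sum_le_sum
      intro i _
      obtain ⟨e, he, rfl⟩ := hne c hc i
      obtain ⟨t, ht, h1, h2⟩ := hno e he
      have : 1 < ((Dv x A v).filter (fun t => c t = c e)).card := by
        rw [Finset.one_lt_card]
        exact ⟨t, by simp [ht, h1], e, by simp [he], h2⟩
      omega
    simp at h2
    omega
  induction n with
  | zero =>
    intro c hc hn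
    exfalso
    obtain ⟨f, hf, hu⟩ := hex c hc
    have : c f ∈ (Finset.univ.filter (fun j : Fin k => ∃ f ∈ Dv x A v, c f = j ∧
        ∀ t ∈ Dv x A v, c t = j → t = f)) := by
      simp only [Finset.mem_filter, Finset.mem_univ, true_and]
      exact ⟨f, hf, rfl, hu⟩
    have := Finset.card_pos.2 ⟨_, this⟩
    omega
  | succ n ih =>
    intro c hc hn
    by_cases hs : Small (Dv x A v) c
    · exact ⟨c, hc, Conn.refl c, hs⟩
    unfold Small at hs
    push Not at hs
    obtain ⟨a, ha, b, hb, z, hz, cab, cbz, nab, nbz, naz⟩ := hs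
    obtain ⟨f, hf, hu⟩ := hex c hc
    have haf : c a ≠ c f := by
      intro h
      exact nab ((hu a ha h).trans (hu b hb (by rw [← cab, h])).symm)
    obtain ⟨c', hc', hconn, e0, he0, hval⟩ := exch1 hk C hG hc ha hb nab cab hf haf hu
    have hfe : f ≠ e0 := by rcases he0 with rfl | rfl <;> grind
    have he0D : e0 ∈ Dv x A v := by rcases he0 with rfl | rfl <;> assumption
    obtain ⟨c'', h1, h2, h3⟩ := ih c' hc' (by
      refine Nat.lt_succ_iff.1 (lt_of_lt_of_le (Finset.card_lt_card ?_) hn)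
      rw [Finset.ssubset_iff_of_subset]
      · refine ⟨c f, ?_, ?_⟩
        · simp only [Finset.mem_filter, Finset.mem_univ, true_and]
          exact ⟨f, hf, rfl, hu⟩
        · simp only [Finset.mem_filter, Finset.mem_univ, true_and]
          rintro ⟨g, hg, -, hgu⟩
          have q1 := hgu f hf (by rw [hval f hf, if_neg hfe])
          have q2 := hgu e0 he0D (by rw [hval e0 he0D, if_pos rfl])
          exact hfe (q1.trans q2.symm)
      · intro j
        simp only [Finset.mem_filter, Finset.mem_univ, true_and]
        rintro ⟨g, hg, hgj, hgu⟩
        have hgf : j ≠ c f := by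
          rintro rfl
          have q1 := hgu f hf (by rw [hval f hf, if_neg hfe])
          have q2 := hgu e0 he0D (by rw [hval e0 he0D, if_pos rfl])
          exact hfe (q1.trans q2.symm)
        have hgj' : c g = j := by
          rw [hval g hg] at hgj
          split_ifs at hgj with h
          · exact absurd hgj.symm hgf
          · exact hgj
        refine ⟨g, hg, hgj', ?_⟩
        intro t ht htj
        have hja : j ≠ c a := by
          rintro rfl
          have va := hval a ha
          have vb := hval b hb
          have vz := hval z hz
          have ga := hgu a ha
          have gb := hgu b hb
          have gz := hgu z hz
          grind
        apply hgu t ht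
        rw [hval t ht]
        grind)
    exact ⟨c'', h1, hconn.trans h2, h3⟩

/-- If colourings with the same pairing are connected, all reduced colourings are connected. -/
lemma pairs_conn (hk : 3 ≤ k) (C : Ctx x A W k) (hG : Graphic x A)
    (hne : ∀ c : E → Fin k, Good x A c → ∀ i, ∃ e ∈ Dv x A v, c e = i)
    (hL : ∀ f, ∀ c c' : E → Fin k, Good x A c → Good x A c' → Pairs (Dv x A v) c f →
      Pairs (Dv x A v) c' f → Conn x A c c')
    (c c' : E → Fin k) (hc : Good x A c) (hc' : Good x A c') (hs : Small (Dv x A v) c)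
    (hs' : Small (Dv x A v) c') : Conn x A c c' := by
  set D := Dv x A v with hD
  let F : (E → E) → Prop := fun f => ∃ c : E → Fin k, Good x A c ∧ Pairs D c f
  let R : (E → E) → (E → E) → Prop := fun f g => ∃ c c' : E → Fin k, Good x A c ∧ Good x A c' ∧
    Pairs D c f ∧ Pairs D c' g ∧ Conn x A c c'
  have X : ExProp F R D := by
    rintro f ⟨c, hc, hp⟩ a haD y hy hay hafy
    have hyD : y ∈ D := by
      by_contra h
      exact hy (hp.off y h)
    have hfyD := hp.mem y hyD
    have hfaD := hp.mem a haD
    have inv := hp.inv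
    have hiff := hp.iff
    have hoff := hp.off
    have hmem := hp.mem
    by_cases hfa : f a = a
    · obtain ⟨c', g1, g2, e0, he0, hval⟩ := exch1 (v := v) hk C hG hc hyD hfyD (Ne.symm hy)
        ((hiff y hyD _ hfyD).2 (Or.inr rfl)).symm haD
        (by intro h; have := (hiff a haD y hyD).1 h; grind)
        (by intro t ht h; have := (hiff a haD t ht).1 h; grind)
      have hsm : Small D c' := by
        intro a1 h1 b1 h2 z1 h3 c1 c2
        rw [hval _ h1, hval _ h2] at c1
        rw [hval _ h2, hval _ h3] at c2
        have q1 := hiff a1 h1 b1 h2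
        have q2 := hiff a1 h1 z1 h3
        have q3 := hiff b1 h2 z1 h3
        have q4 := hiff a haD a1 h1
        have q5 := hiff a haD b1 h2
        have q6 := hiff a haD z1 h3
        grind
      obtain ⟨f', hf'⟩ := exists_pairs hsm
      have he0D : e0 ∈ D := by rcases he0 with rfl | rfl <;> assumption
      refine ⟨f', ⟨c', g1, hf'⟩, ⟨c, c', hc, g1, hp, hf', g2⟩, ?_, ?_⟩
      · intro z z1 z2 z3 z4
        by_cases hzD : z ∈ D
        · have hfz := hmem z hzD
          have q := (hf'.iff z hzD (f z) hfz).1 (by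
            rw [hval _ hzD, hval _ hfz]
            have := (hiff z hzD _ hfz).2 (Or.inr rfl)
            grind)
          have q0 := hf'.mem z hzD
          have q2 := (hf'.iff z hzD (f' z) q0).2 (Or.inr rfl)
          rw [hval _ hzD, hval _ q0] at q2
          have q3 := hiff z hzD (f' z) q0
          have q4 := hiff z hzD a haD
          grind
        · rw [hf'.off z hzD, hoff z hzD]
      · have q := (hf'.iff a haD e0 he0D).1 (by rw [hval _ haD, hval _ he0D]; grind)
        grind
    · obtain ⟨c', g1, g2, w, hw, hval⟩ := exch2 (v := v) hk C hG hc hyD hfyD haD hfaD (Ne.symm hy)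
        (Ne.symm hfa) ((hiff y hyD _ hfyD).2 (Or.inr rfl)).symm
        ((hiff a haD _ hfaD).2 (Or.inr rfl)).symm
        (by intro h; have := (hiff a haD y hyD).1 h; grind)
        (by intro t ht h; exact (hiff y hyD t ht).1 h)
        (by intro t ht h; exact (hiff a haD t ht).1 h)
      have hwD : w ∈ D := by rcases hw with rfl | rfl <;> assumption
      have hcy : ∀ t ∈ D, (c t = c y ↔ t = y ∨ t = f y) := hiff y hyD
      have hca : ∀ t ∈ D, (c t = c a ↔ t = a ∨ t = f a) := hiff a haD
      have hcw : c w = c a := (hca w hwD).2 hw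
      have hsm : Small D c' := by
        intro a1 h1 b1 h2 z1 h3 c1 c2
        rw [hval _ h1, hval _ h2] at c1
        rw [hval _ h2, hval _ h3] at c2
        unfold swapc at c1 c2
        have q1 := hiff a1 h1 b1 h2
        have q2 := hiff a1 h1 z1 h3
        have q3 := hiff b1 h2 z1 h3
        have q4 := hca a1 h1
        have q5 := hca b1 h2
        have q6 := hca z1 h3
        have q7 := hcy a1 h1
        have q8 := hcy b1 h2
        have q9 := hcy z1 h3
        grind
      obtain ⟨f', hf'⟩ := exists_pairs hsm
      refine ⟨f', ⟨c', g1, hf'⟩, ⟨c, c', hc, g1, hp, hf', g2⟩, ?_, ?_⟩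
      · intro z z1 z2 z3 z4
        by_cases hzD : z ∈ D
        · have hfz := hmem z hzD
          have q := (hf'.iff z hzD (f z) hfz).1 (by
            rw [hval _ hzD, hval _ hfz]
            have := (hiff z hzD _ hfz).2 (Or.inr rfl)
            unfold swapc
            grind)
          have q0 := hf'.mem z hzD
          have q2 := (hf'.iff z hzD (f' z) q0).2 (Or.inr rfl)
          rw [hval _ hzD, hval _ q0] at q2
          unfold swapc at q2
          have q3 := hiff z hzD (f' z) q0
          have q4 := hca z hzD
          have q5 := hcy z hzD
          grind
        · rw [hf'.off z hzD, hoff z hzD]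
      · have hva := hval a haD
        have hvy := hval y hyD
        have hvfy := hval (f y) hfyD
        have hvfa := hval (f a) hfaD
        unfold swapc at hva hvy hvfy hvfa
        have r1 := hcy a haD
        have r2 := hcy (f y) hfyD
        have r3 := hca (f a) hfaD
        have q1 := hf'.iff a haD y hyD
        have q2 := hf'.iff a haD (f y) hfyD
        grind
  have hrefl : ∀ f, F f → R f f := by
    rintro f ⟨c, h1, h2⟩
    exact ⟨c, c, h1, h1, h2, h2, Conn.refl c⟩
  have hsymm : ∀ f g, R f g → R g f := by
    rintro f g ⟨c, c', h1, h2, h3, h4, h5⟩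
    exact ⟨c', c, h2, h1, h4, h3, h5.symm⟩
  have htrans : ∀ f g h, R f g → R g h → R f h := by
    rintro f g h ⟨c1, c2, h1, h2, h3, h4, h5⟩ ⟨d1, d2, k1, k2, k3, k4, k5⟩
    exact ⟨c1, d2, h1, k2, h3, k4, h5.trans ((hL g c2 d1 h2 k1 h4 k3).trans k5)⟩
  obtain ⟨f, hf⟩ := exists_pairs hs
  obtain ⟨f', hf'⟩ := exists_pairs hs'
  obtain ⟨c1, c2, h1, h2, h3, h4, h5⟩ := match_conn F R D hrefl hsymm htrans
    (fun f ⟨c, _, h⟩ => h.inv)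
    (fun f ⟨c, _, h⟩ e he => by by_contra hn; exact he (h.off e hn))
    (2 * D.card - 2 * k) (fun f ⟨c, h1, h⟩ => h.count (hne c h1)) X f f' ⟨c, hc, hf⟩ ⟨c', hc', hf'⟩
  exact (hL f c c1 hc h1 hf h3).trans (h5.trans (hL f' c2 c' h2 hc' h4 hf'))

end pairs
end KB

namespace KB
set_option linter.unusedSectionVars false
set_option linter.unusedVariables false
open Module Submodule

section lift
variable {V E : Type*} [Fintype V] [Fintype E] [DecidableEq V] [DecidableEq E] {k : ℕ}

/-- the vectors of the split graph -/
def sx (x : E → V → ℚ) (f : E → E) (R : Finset E) : E → V → ℚ :=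
  fun e => if e ∈ R then x e - x (f e) else x e

/-- the edges of the split graph -/
def sA (x : E → V → ℚ) (A : Finset E) (v : V) (R : Finset E) : Finset E := (A \ Dv x A v) ∪ R

structure LS (x : E → V → ℚ) (A : Finset E) (W W' : Submodule ℚ (V → ℚ)) (v : V) (f : E → E)
    (R : Finset E) (k : ℕ) : Prop where
  C : Ctx x A W k
  hv : ∀ e ∈ A, x e v = 0 ∨ x e v = 1
  hne : ∀ c : E → Fin k, Good x A c → ∀ i, ∃ e ∈ Dv x A v, c e = i
  inv : ∀ e, f (f e) = e
  mem : ∀ e ∈ Dv x A v, f e ∈ Dv x A v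
  Rsub : ∀ e ∈ R, e ∈ Dv x A v ∧ f e ≠ e
  Rpair : ∀ e ∈ Dv x A v, f e ≠ e → (e ∈ R ↔ f e ∉ R)
  C' : Ctx (sx x f R) (sA x A v R) W' k
  hW' : ∀ w, w ∈ W' ↔ w ∈ W ∧ w v = 0
  rk : finrank ℚ W' + 1 = finrank ℚ W
  cardA : A.card = k * finrank ℚ W

variable {x : E → V → ℚ} {A : Finset E} {W W' : Submodule ℚ (V → ℚ)} {v : V} {f : E → E}
  {R : Finset E}

lemma mem_sA {e : E} : e ∈ sA x A v R ↔ (e ∈ A ∧ e ∉ Dv x A v) ∨ e ∈ R := by simp [sA]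

lemma Dsub {e : E} (h : e ∈ Dv x A v) : e ∈ A := (mem_Dv.1 h).1

lemma LS.off_zero (S : LS x A W W' v f R k) {e : E} (he : e ∈ A) (hD : e ∉ Dv x A v) :
    x e v = 0 := by
  rcases S.hv e he with h | h
  · exact h
  · exact absurd (mem_Dv.2 ⟨he, h⟩) hD

lemma LS.sx_off (S : LS x A W W' v f R k) {e : E} (hD : e ∉ R) : sx x f R e = x e := by
  simp [sx, hD]

/-- choice of the lifted class -/
lemma LS.exists_B (S : LS x A W W' v f R k) (H : Finset E)
    (hH : H ⊆ sA x A v R ∧ LinearIndepOn ℚ (sx x f R) (H : Set E) ∧ H.card = finrank ℚ W' ∧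
      (H ∩ R).Nonempty) :
    ∃ B : Finset E, B ⊆ A ∧ (∀ e ∈ H, e ∉ R → e ∈ B) ∧
      (∀ e ∈ B, (e ∈ H ∧ e ∉ R) ∨ (e ∈ H ∧ e ∈ R) ∨ (f e ∈ H ∧ f e ∈ R)) ∧
      LinearIndepOn ℚ x (B : Set E) ∧ B.card = finrank ℚ W := by
  classical
  obtain ⟨hsub, hind, hcard, a, ha⟩ := hH
  rw [Finset.mem_inter] at ha
  set F : Finset E := H \ R with hF
  set U : Finset E := F ∪ ((H ∩ R) ∪ (H ∩ R).image f) with hU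
  have hUmem : ∀ e ∈ U, (e ∈ H ∧ e ∉ R) ∨ (e ∈ H ∧ e ∈ R) ∨ (f e ∈ H ∧ f e ∈ R) := by
    intro e he
    simp only [hU, hF, Finset.mem_union, Finset.mem_sdiff, Finset.mem_inter, Finset.mem_image] at he
    rcases he with h | h | ⟨b, hb, rfl⟩
    · exact Or.inl h
    · exact Or.inr (Or.inl h)
    · rw [S.inv]; exact Or.inr (Or.inr hb)
  have hUA : U ⊆ A := by
    intro e he
    rcases hUmem e he with ⟨h1, h2⟩ | ⟨h1, h2⟩ | ⟨h1, h2⟩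
    · rcases mem_sA.1 (hsub h1) with h | h
      · exact h.1
      · exact absurd h h2
    · exact Dsub (S.Rsub e h2).1
    · have := S.mem _ (S.Rsub _ h2).1
      rw [S.inv] at this
      exact Dsub this
  have hFU : (F : Set E) ⊆ (U : Set E) := by
    intro e he
    simp only [hU, Finset.coe_union]
    exact Or.inl he
  have hFind : LinearIndepOn ℚ x (F : Set E) := by
    refine (hind.mono (t := (F : Set E)) ?_).congr ?_
    · intro e he
      simp only [hF, Finset.coe_sdiff, Set.mem_sdiff, Finset.mem_coe] at he
      exact he.1
    · intro e he
      simp only [hF, Finset.coe_sdiff, Set.mem_sdiff, Finset.mem_coe] at he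
      exact S.sx_off he.2
  have hsH : span ℚ (sx x f R '' (H : Set E)) = W' :=
    span_eq_of_card hind (fun e he => S.C'.mem e (hsub he)) hcard
  have hspan : span ℚ (x '' (U : Set E)) = W := by
    apply le_antisymm (span_le_W S.C.mem hUA)
    have h1 : W' ≤ span ℚ (x '' (U : Set E)) := by
      rw [← hsH, span_le]
      rintro _ ⟨e, he, rfl⟩
      by_cases heR : e ∈ R
      · simp only [sx, heR, if_true]
        refine sub_mem (subset_span ⟨e, ?_, rfl⟩) (subset_span ⟨f e, ?_, rfl⟩)
        · simp only [hU, Finset.mem_coe, Finset.mem_union, Finset.mem_inter]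
          exact Or.inr (Or.inl ⟨he, heR⟩)
        · simp only [hU, Finset.mem_coe, Finset.mem_union, Finset.mem_image, Finset.mem_inter]
          exact Or.inr (Or.inr ⟨e, ⟨he, heR⟩, rfl⟩)
      · rw [S.sx_off heR]
        refine subset_span ⟨e, hFU ?_, rfl⟩
        simp only [hF, Finset.mem_coe, Finset.mem_sdiff]
        exact ⟨he, heR⟩
    have haU : x a ∈ span ℚ (x '' (U : Set E)) := by
      refine subset_span ⟨a, ?_, rfl⟩
      simp only [hU, Finset.mem_coe, Finset.mem_union, Finset.mem_inter]
      exact Or.inr (Or.inl ha)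
    have hav := mem_Dv.1 (S.Rsub a ha.2).1
    intro w hw
    have h2 : w - (w v) • x a ∈ W' := by
      rw [S.hW']
      refine ⟨W.sub_mem hw (W.smul_mem _ (S.C.mem a hav.1)), ?_⟩
      simp [hav.2]
    have := add_mem (h1 h2) (Submodule.smul_mem _ (w v) haU)
    simpa using this
  have hfin : (hFind.extend hFU).Finite := Set.toFinite _
  refine ⟨hfin.toFinset, ?_, ?_, ?_, ?_, ?_⟩
  · intro e he
    rw [Set.Finite.mem_toFinset] at he
    exact hUA (hFind.extend_subset hFU he)
  · intro e he heR
    rw [Set.Finite.mem_toFinset]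
    apply hFind.subset_extend hFU
    simp only [hF, Finset.mem_coe, Finset.mem_sdiff]
    exact ⟨he, heR⟩
  · intro e he
    rw [Set.Finite.mem_toFinset] at he
    exact hUmem e (hFind.extend_subset hFU he)
  · rw [Set.Finite.coe_toFinset]
    exact hFind.linearIndepOn_extend hFU
  · have h1 : LinearIndepOn ℚ x (hfin.toFinset : Set E) := by
      rw [Set.Finite.coe_toFinset]
      exact hFind.linearIndepOn_extend hFU
    rw [← finrank_span_indep h1, Set.Finite.coe_toFinset,
      hFind.span_image_extend_eq_span_image hFU, hspan]

structure Lift (x : E → V → ℚ) (A : Finset E) (v : V) (f : E → E) (R : Finset E)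
    (γ c : E → Fin k) : Prop where
  good : Good x A c
  eq : ∀ e ∈ A, e ∉ Dv x A v → c e = γ e
  sing : ∀ s ∈ Dv x A v, f s = s → ∀ a ∈ R, γ a ≠ c s

lemma LS.exists_lift (S : LS x A W W' v f R k) (Bs : Finset E → Finset E)
    (hBs : ∀ H, (H ⊆ sA x A v R ∧ LinearIndepOn ℚ (sx x f R) (H : Set E) ∧
      H.card = finrank ℚ W' ∧ (H ∩ R).Nonempty) →
      Bs H ⊆ A ∧ (∀ e ∈ H, e ∉ R → e ∈ Bs H) ∧
      (∀ e ∈ Bs H, (e ∈ H ∧ e ∉ R) ∨ (e ∈ H ∧ e ∈ R) ∨ (f e ∈ H ∧ f e ∈ R)) ∧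
      LinearIndepOn ℚ x (Bs H : Set E) ∧ (Bs H).card = finrank ℚ W)
    (γ : E → Fin k) (hγ : Good (sx x f R) (sA x A v R) γ) :
    ∃ c, Lift x A v f R γ c ∧ ∀ i, (∃ a ∈ R, γ a = i) → cls A c i = Bs (cls (sA x A v R) γ i) := by
  classical
  set D := Dv x A v with hD
  set H : Fin k → Finset E := fun i => cls (sA x A v R) γ i with hH
  have memH : ∀ i e, e ∈ H i ↔ ((e ∈ A ∧ e ∉ D) ∨ e ∈ R) ∧ γ e = i := by
    intro i e; rw [hH]; simp only [mem_cls, mem_sA]; rfl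
  have RD : ∀ e ∈ R, e ∈ D := fun e he => (S.Rsub e he).1
  have hB : ∀ i, (∃ a ∈ R, γ a = i) → Bs (H i) ⊆ A ∧ (∀ e ∈ H i, e ∉ R → e ∈ Bs (H i)) ∧
      (∀ e ∈ Bs (H i), (e ∈ H i ∧ e ∉ R) ∨ (e ∈ H i ∧ e ∈ R) ∨ (f e ∈ H i ∧ f e ∈ R)) ∧
      LinearIndepOn ℚ x (Bs (H i) : Set E) ∧ (Bs (H i)).card = finrank ℚ W := by
    rintro i ⟨a, ha, hai⟩
    refine hBs (H i) ⟨cls_subset _ _ _, hγ i, S.C'.card_cls hγ i, a, ?_⟩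
    rw [Finset.mem_inter]
    exact ⟨(memH i a).2 ⟨Or.inr ha, hai⟩, ha⟩
  -- provisional colours
  set col : E → Fin k := fun e => if e ∈ D then (if e ∈ R then γ e else γ (f e)) else γ e with hcol
  set nz : Fin k → Prop := fun i => ∃ a ∈ R, γ a = i with hnz
  set Tk : Finset E := A.filter (fun e => e ∉ D ∨ (nz (col e) ∧ e ∈ Bs (H (col e)))) with hTk
  have fib1 : ∀ i, nz i → cls Tk col i = Bs (H i) := by
    intro i hi
    obtain ⟨b1, b2, b3, b4, b5⟩ := hB i hi
    ext e
    simp only [mem_cls, hTk, Finset.mem_filter]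
    constructor
    · rintro ⟨⟨heA, h⟩, hc⟩
      rcases h with h | ⟨h1, h2⟩
      · apply b2 e
        · rw [memH]
          refine ⟨Or.inl ⟨heA, h⟩, ?_⟩
          simpa [hcol, h] using hc
        · exact fun hR => h (RD e hR)
      · rw [hc] at h2; exact h2
    · intro he
      have hci : col e = i := by
        rcases b3 e he with ⟨h1, h2⟩ | ⟨h1, h2⟩ | ⟨h1, h2⟩
        · rw [memH] at h1
          have : e ∉ D := by
            rcases h1.1 with h | h
            · exact h.2
            · exact absurd h h2
          simp [hcol, this, h1.2]
        · rw [memH] at h1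
          simp [hcol, RD e h2, h2, h1.2]
        · rw [memH] at h1
          have q1 := S.Rsub _ h2
          have q2 := S.mem _ q1.1
          have q3 := (S.Rpair _ q1.1 q1.2).1 h2
          rw [S.inv] at q2 q3
          have q2' : e ∈ D := q2
          simp [hcol, q2', q3, h1.2]
      refine ⟨⟨b1 he, ?_⟩, hci⟩
      right
      rw [hci]
      exact ⟨hi, he⟩
  have fib0 : ∀ i, ¬ nz i → cls Tk col i = H i := by
    intro i hi
    ext e
    rw [memH]
    simp only [mem_cls, hTk, Finset.mem_filter]
    constructor
    · rintro ⟨⟨heA, h⟩, hc⟩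
      rcases h with h | ⟨h1, h2⟩
      · refine ⟨Or.inl ⟨heA, h⟩, ?_⟩
        simpa [hcol, h] using hc
      · rw [hc] at h1; exact absurd h1 hi
    · rintro ⟨h | h, hc⟩
      · refine ⟨⟨h.1, Or.inl h.2⟩, ?_⟩
        simp [hcol, h.2, hc]
      · exact absurd ⟨e, h, hc⟩ hi
  have hTkcard : Tk.card + (Finset.univ.filter (fun i => ¬ nz i)).card = k * finrank ℚ W := by
    rw [← sum_card_cls Tk col, Finset.card_filter, ← Finset.sum_add_distrib]
    have : ∀ i ∈ (Finset.univ : Finset (Fin k)),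
        (cls Tk col i).card + (if ¬ nz i then 1 else 0) = finrank ℚ W := by
      intro i _
      by_cases hi : nz i
      · rw [fib1 i hi, (hB i hi).2.2.2.2]; simp [hi]
      · rw [fib0 i hi, if_pos hi, ← S.rk]
        congr 1
        exact S.C'.card_cls hγ i
    rw [Finset.sum_congr rfl this]
    simp
  set Z : Finset E := A \ Tk with hZ
  have hTkA : Tk ⊆ A := Finset.filter_subset _ _
  have hZcard : Z.card ≤ (Finset.univ.filter (fun i => ¬ nz i)).card := by
    have h1 := Finset.card_sdiff_add_card_eq_card hTkA
    have h2 := S.cardA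
    rw [hZ]
    omega
  obtain ⟨β, hβ1, hβ2⟩ : ∃ β : E → Fin k, (∀ e ∈ Z, ¬ nz (β e)) ∧
      ∀ e ∈ Z, ∀ e' ∈ Z, β e = β e' → e = e' := by
    obtain ⟨emb⟩ := Function.Embedding.nonempty_of_card_le
      (α := Z) (β := (Finset.univ.filter (fun i => ¬ nz i))) (by
        rw [Fintype.card_coe, Fintype.card_coe]; exact hZcard)
    refine ⟨fun e => if h : e ∈ Z then (emb ⟨e, h⟩ : Fin k) else γ e, ?_, ?_⟩
    · intro e he
      have := (emb ⟨e, he⟩).2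
      rw [Finset.mem_filter] at this
      simpa [he] using this.2
    · intro e he e' he' h
      simp only [he, he', dif_pos] at h
      have := emb.injective (Subtype.ext h)
      simpa using this
  set c : E → Fin k := fun e => if e ∈ Tk then col e else β e with hcdef
  have ZD : ∀ e ∈ Z, e ∈ D := by
    intro e he
    rw [hZ, Finset.mem_sdiff, hTk, Finset.mem_filter] at he
    by_contra h
    exact he.2 ⟨he.1, Or.inl h⟩
  have memZ : ∀ e, e ∈ Z ↔ e ∈ A ∧ e ∉ Tk := by
    intro e; rw [hZ, Finset.mem_sdiff]
  have clsnz : ∀ i, nz i → cls A c i = Bs (H i) := by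
    intro i hi
    rw [← fib1 i hi]
    ext e
    simp only [mem_cls, hcdef]
    constructor
    · rintro ⟨h1, h2⟩
      by_cases h3 : e ∈ Tk
      · rw [if_pos h3] at h2; exact ⟨h3, h2⟩
      · rw [if_neg h3] at h2
        exact absurd hi (h2 ▸ hβ1 e ((memZ e).2 ⟨h1, h3⟩))
    · rintro ⟨h1, h2⟩
      exact ⟨hTkA h1, by rw [if_pos h1, h2]⟩
  refine ⟨c, ⟨?_, ?_, ?_⟩, clsnz⟩
  · intro i
    by_cases hi : nz i
    · rw [clsnz i hi]
      exact (hB i hi).2.2.2.1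
    · have hHi : LinearIndepOn ℚ x (H i : Set E) := by
        refine (hγ i).congr ?_
        intro e he
        apply S.sx_off
        intro heR
        exact hi ⟨e, heR, ((memH i e).1 he).2⟩
      have hH0 : ∀ e ∈ H i, x e v = 0 := by
        intro e he
        rcases (memH i e).1 he with ⟨h | h, h2⟩
        · exact S.off_zero h.1 h.2
        · exact absurd ⟨e, h, h2⟩ hi
      have hsub : ∀ e ∈ cls A c i, e ∈ H i ∨ (e ∈ Z ∧ β e = i) := by
        intro e he
        rw [mem_cls] at he
        obtain ⟨h1, h2⟩ := he
        simp only [hcdef] at h2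
        by_cases h3 : e ∈ Tk
        · rw [if_pos h3] at h2
          left
          rw [← fib0 i hi]
          exact mem_cls.2 ⟨h3, h2⟩
        · rw [if_neg h3] at h2
          exact Or.inr ⟨(memZ e).2 ⟨h1, h3⟩, h2⟩
      by_cases hz : ∃ z ∈ Z, β z = i
      · obtain ⟨z, hz, hzi⟩ := hz
        have hn : x z ∉ span ℚ (x '' (H i : Set E)) := by
          apply notMem_span_of_dual (LinearMap.proj v : (V → ℚ) →ₗ[ℚ] ℚ)
          · intro t ht; exact hH0 t ht
          · have := (mem_Dv.1 (ZD z hz)).2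
            simp [this]
        refine (hHi.insert hn).mono ?_
        intro e he
        rcases hsub e he with h | ⟨h, h2⟩
        · exact Or.inr h
        · exact Or.inl (hβ2 e h z hz (h2.trans hzi.symm))
      · refine hHi.mono ?_
        intro e he
        rcases hsub e he with h | h
        · exact h
        · exact absurd ⟨e, h⟩ hz
  · intro e he heD
    have h1 : e ∈ Tk := by rw [hTk, Finset.mem_filter]; exact ⟨he, Or.inl heD⟩
    have h2 : e ∉ D := heD
    simp [hcdef, h1, hcol, h2]
  · intro s hs hfs a ha
    have hsD : s ∈ D := hs
    have h1 : s ∉ Tk := by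
      rw [hTk, Finset.mem_filter]
      rintro ⟨h2, h3 | ⟨h3, h4⟩⟩
      · exact h3 hs
      · rcases (hB _ h3).2.2.1 s h4 with ⟨h5, h6⟩ | ⟨h5, h6⟩ | ⟨h5, h6⟩
        · rcases ((memH _ _).1 h5).1 with h | h
          · exact h.2 hsD
          · exact h6 h
        · exact (S.Rsub s h6).2 hfs
        · exact (S.Rsub _ h6).2 (by rw [hfs, hfs])
    have h2 : c s = β s := by simp [hcdef, h1]
    rw [h2]
    intro h3
    exact hβ1 s ((memZ s).2 ⟨Dsub hs, h1⟩) ⟨a, ha, h3⟩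

lemma LS.zero_unique (S : LS x A W W' v f R k) {γ c : E → Fin k}
    (hγ : Good (sx x f R) (sA x A v R) γ) (hL : Lift x A v f R γ c) {j : Fin k}
    (hj : ∀ a ∈ R, γ a ≠ j) {e e' : E} (he : e ∈ Dv x A v) (he' : e' ∈ Dv x A v)
    (h : c e = j) (h' : c e' = j) : e = e' := by
  by_contra hne
  have h1 : insert e (insert e' (cls (sA x A v R) γ j)) ⊆ cls A c j := by
    intro t ht
    rw [Finset.mem_insert, Finset.mem_insert] at ht
    rcases ht with rfl | rfl | ht
    · exact mem_cls.2 ⟨Dsub he, h⟩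
    · exact mem_cls.2 ⟨Dsub he', h'⟩
    · rw [mem_cls, mem_sA] at ht
      rcases ht.1 with h2 | h2
      · exact mem_cls.2 ⟨h2.1, by rw [hL.eq t h2.1 h2.2, ht.2]⟩
      · exact absurd ht.2 (hj t h2)
  have h2 := Finset.card_le_card h1
  have nm : ∀ t ∈ Dv x A v, t ∉ cls (sA x A v R) γ j := by
    intro t ht h3
    rw [mem_cls, mem_sA] at h3
    rcases h3.1 with h4 | h4
    · exact h4.2 ht
    · exact hj t h4 h3.2
  rw [Finset.card_insert_of_notMem, Finset.card_insert_of_notMem (nm e' he'),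
    S.C'.card_cls hγ, S.C.card_cls hL.good] at h2
  · have := S.rk; omega
  · rw [Finset.mem_insert]; push Not
    exact ⟨hne, nm e he⟩

lemma LS.move (hk : 3 ≤ k) (S : LS x A W W' v f R k) {γ c : E → Fin k}
    (hγ : Good (sx x f R) (sA x A v R) γ) (hL : Lift x A v f R γ c) {j : Fin k}
    (hj : ∀ a ∈ R, γ a ≠ j) {s : E} (hs : s ∈ Dv x A v) (hfs : f s = s) :
    ∃ c2, Lift x A v f R γ c2 ∧ Conn x A c c2 ∧ c2 s = j := by
  by_cases hcs : c s = j
  · exact ⟨c, hL, Conn.refl c, hcs⟩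
  obtain ⟨t, ht, htj⟩ := S.hne c hL.good j
  have key : ∀ u ∈ Dv x A v, (∀ a ∈ R, γ a ≠ c u) → ∀ w ∈ Dv x A v,
      x w ∉ span ℚ (x '' ((cls A c (c u) : Set E) \ {u})) := by
    intro u hu hz w hw
    apply notMem_span_of_dual (LinearMap.proj v : (V → ℚ) →ₗ[ℚ] ℚ)
    · rintro y ⟨hy, hyu⟩
      have hy := mem_cls.1 hy
      refine S.off_zero hy.1 (fun hD => hyu ?_)
      exact S.zero_unique hγ hL hz hD hu hy.2 rfl
    · simp [(mem_Dv.1 hw).2]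
  have hst : c s ≠ c t := by rw [htj]; exact hcs
  have zs := hL.sing s hs hfs
  have zt : ∀ a ∈ R, γ a ≠ c t := by rw [htj]; exact hj
  have hg := swap_good hL.good (Dsub hs) (Dsub ht) hst (key s hs zs t ht) (key t ht zt s hs)
  refine ⟨swapc c s t, ⟨hg, ?_, ?_⟩, (swap_step hk hL.good hg).conn, by simp [swapc, htj]⟩
  · intro e he heD
    have h1 : e ≠ s := by rintro rfl; exact heD hs
    have h2 : e ≠ t := by rintro rfl; exact heD ht
    simp [swapc, h1, h2, hL.eq e he heD]
  · intro u hu hfu a ha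
    simp only [swapc]
    split_ifs
    · exact zt a ha
    · exact zs a ha
    · exact hL.sing u hu hfu a ha

/-- two colourings putting `s` in the same zero class, lifting colourings sharing that class -/
lemma LS.share (S : LS x A W W' v f R k) {γ γ' c c' : E → Fin k}
    (hγ : Good (sx x f R) (sA x A v R) γ) (hγ' : Good (sx x f R) (sA x A v R) γ')
    (hL : Lift x A v f R γ c) (hL' : Lift x A v f R γ' c') {j : Fin k}
    (hj : ∀ a ∈ R, γ a ≠ j) (hsh : ∀ e ∈ sA x A v R, (γ e = j ↔ γ' e = j))
    {s : E} (hs : s ∈ Dv x A v) (h1 : c s = j) (h2 : c' s = j) : Conn x A c c' := by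
  have hj' : ∀ a ∈ R, γ' a ≠ j := fun a ha h =>
    hj a ha ((hsh a (mem_sA.2 (Or.inr ha))).2 h)
  refine Step.conn ⟨hL.good, hL'.good, j, fun e he => ?_⟩
  by_cases heD : e ∈ Dv x A v
  · constructor
    · intro h
      rw [S.zero_unique hγ hL hj heD hs h h1]; exact h2
    · intro h
      rw [S.zero_unique hγ' hL' hj' heD hs h h2]; exact h1
  · rw [hL.eq e he heD, hL'.eq e he heD]
    exact hsh e (mem_sA.2 (Or.inl ⟨he, heD⟩))

lemma LS.same (hk : 3 ≤ k) (S : LS x A W W' v f R k) {γ c c' : E → Fin k}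
    (hγ : Good (sx x f R) (sA x A v R) γ)
    (hL : Lift x A v f R γ c) (hL' : Lift x A v f R γ c')
    {s : E} (hs : s ∈ Dv x A v) (hfs : f s = s) : Conn x A c c' := by
  have hj := hL.sing s hs hfs
  obtain ⟨c2, h1, h2, h3⟩ := S.move hk hγ hL' hj hs hfs
  exact (S.share hγ hγ hL h1 hj (fun _ _ => Iff.rfl) hs rfl h3).trans h2.symm

lemma LS.lift_step (hk : 3 ≤ k) (S : LS x A W W' v f R k) {γ γ' c c' : E → Fin k}
    (hst : Step (sx x f R) (sA x A v R) γ γ')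
    (hL : Lift x A v f R γ c) (hL' : Lift x A v f R γ' c')
    {s : E} (hs : s ∈ Dv x A v) (hfs : f s = s) : Conn x A c c' := by
  obtain ⟨hγ, hγ', i, hi⟩ := hst
  by_cases hnz : ∀ a ∈ R, γ a ≠ i
  · have hnz' : ∀ a ∈ R, γ' a ≠ i := fun a ha h =>
      hnz a ha ((hi a (mem_sA.2 (Or.inr ha))).2 h)
    obtain ⟨d, d1, d2, d3⟩ := S.move hk hγ hL hnz hs hfs
    obtain ⟨d', d1', d2', d3'⟩ := S.move hk hγ' hL' hnz' hs hfs
    exact d2.trans ((S.share hγ hγ' d1 d1' hnz hi hs d3 d3').trans d2'.symm)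
  · push Not at hnz
    have := S.exists_B
    choose! Bs hBs using this
    obtain ⟨d, d1, d2⟩ := S.exists_lift Bs hBs γ hγ
    obtain ⟨d', d1', d2'⟩ := S.exists_lift Bs hBs γ' hγ'
    have hnz' : ∃ a ∈ R, γ' a = i := by
      obtain ⟨a, ha, h⟩ := hnz
      exact ⟨a, ha, (hi a (mem_sA.2 (Or.inr ha))).1 h⟩
    have hcl : cls A d i = cls A d' i := by
      rw [d2 i hnz, d2' i hnz']
      congr 1
      ext e
      simp only [mem_cls]
      constructor
      · rintro ⟨h1, h2⟩; exact ⟨h1, (hi e h1).1 h2⟩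
      · rintro ⟨h1, h2⟩; exact ⟨h1, (hi e h1).2 h2⟩
    have hstep : Step x A d d' := by
      refine ⟨d1.good, d1'.good, i, fun e he => ?_⟩
      have : e ∈ cls A d i ↔ e ∈ cls A d' i := by rw [hcl]
      simpa [mem_cls, he] using this
    exact (S.same hk hγ hL d1 hs hfs).trans
      (hstep.conn.trans (S.same hk hγ' d1' hL' hs hfs))

lemma LS.lift_conn (hk : 3 ≤ k) (S : LS x A W W' v f R k) {γ γ' : E → Fin k}
    (hγ : Good (sx x f R) (sA x A v R) γ)
    (hcn : Conn (sx x f R) (sA x A v R) γ γ') {s : E} (hs : s ∈ Dv x A v) (hfs : f s = s) :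
    ∀ c c', Lift x A v f R γ c → Lift x A v f R γ' c' → Conn x A c c' := by
  unfold Conn at hcn
  induction hcn with
  | refl => exact fun c c' hL hL' => S.same hk hγ hL hL' hs hfs
  | tail h1 h2 ih =>
    intro c c' hL hL'
    have := S.exists_B
    choose! Bs hBs using this
    obtain ⟨d, d1, d2⟩ := S.exists_lift Bs hBs _ h2.1
    exact (ih c d hL d1).trans (S.lift_step hk h2 d1 hL' hs hfs)

end lift
end KB

namespace KB
set_option linter.unusedSectionVars false
set_option linter.unusedVariables false
open Module Submodule

section build
variable {V E : Type*} [Fintype V] [Fintype E] [DecidableEq V] [DecidableEq E] {k : ℕ}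
variable {x : E → V → ℚ} {A : Finset E} {W W' : Submodule ℚ (V → ℚ)} {v : V} {f : E → E}
  {R : Finset E}

lemma restrict_good {c : E → Fin k} (hc : Good x A c) (hP : Pairs (Dv x A v) c f)
    (Rsub : ∀ e ∈ R, e ∈ Dv x A v ∧ f e ≠ e)
    (Rpair : ∀ e ∈ Dv x A v, f e ≠ e → (e ∈ R ↔ f e ∉ R)) :
    Good (sx x f R) (sA x A v R) c := by
  classical
  intro i
  set F : Set E := {e | e ∈ A ∧ e ∉ Dv x A v ∧ c e = i} with hF
  have hFR : ∀ e ∈ F, e ∉ R := fun e he hR => he.2.1 (Rsub e hR).1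
  have hFind : LinearIndepOn ℚ (sx x f R) F := by
    refine ((hc i).mono (t := F) ?_).congr ?_
    · intro e he; exact mem_cls.2 ⟨he.1, he.2.2⟩
    · intro e he
      simp [sx, hFR e he]
  by_cases ha : ∃ a ∈ R, c a = i
  · obtain ⟨a, haR, hai⟩ := ha
    obtain ⟨haD, hfa⟩ := Rsub a haR
    obtain ⟨p, hp1, hp⟩ := exists_dual (hc i) (mem_cls.2 ⟨Dsub haD, hai⟩)
    have hfD := hP.mem a haD
    have hfc : c (f a) = c a := (hP.iff a haD _ hfD).2 (Or.inr rfl)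
    have hn : sx x f R a ∉ span ℚ (sx x f R '' F) := by
      apply notMem_span_of_dual p
      · intro t ht
        simp only [sx, hFR t ht, if_false]
        exact hp t (mem_cls.2 ⟨ht.1, ht.2.2⟩) (by rintro rfl; exact ht.2.1 haD)
      · simp only [sx, haR, if_true, map_sub, hp1,
          hp (f a) (mem_cls.2 ⟨Dsub hfD, hfc.trans hai⟩) hfa]
        norm_num
    refine (hFind.insert hn).mono ?_
    intro e he
    have he := mem_cls.1 he
    rcases mem_sA.1 he.1 with h | h
    · exact Or.inr ⟨h.1, h.2, he.2⟩
    · left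
      rcases (hP.iff a haD e (Rsub e h).1).1 (he.2.trans hai.symm) with h1 | h1
      · exact h1
      · rw [h1] at h
        exact absurd h ((Rpair a haD hfa).1 haR)
  · refine hFind.mono ?_
    intro e he
    have he := mem_cls.1 he
    rcases mem_sA.1 he.1 with h | h
    · exact ⟨h.1, h.2, he.2⟩
    · exact absurd ⟨e, h, he.2⟩ ha

lemma lift_self {c : E → Fin k} (hc : Good x A c) (hP : Pairs (Dv x A v) c f)
    (Rsub : ∀ e ∈ R, e ∈ Dv x A v ∧ f e ≠ e) : Lift x A v f R c c := by
  refine ⟨hc, fun _ _ _ => rfl, fun s hs hfs a ha h => ?_⟩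
  have h1 := (hP.iff s hs a (Rsub a ha).1).1 h
  rw [hfs, or_self] at h1
  subst h1
  exact (Rsub a ha).2 hfs

lemma split_conn (hk : 3 ≤ k) (C : Ctx x A W k) (hG : Graphic x A)
    (hv : ∀ e ∈ A, x e v = 0 ∨ x e v = 1)
    (hne : ∀ c : E → Fin k, Good x A c → ∀ i, ∃ e ∈ Dv x A v, c e = i)
    (hd : (Dv x A v).card < 2 * k)
    (IH : ∀ (x' : E → V → ℚ) (A' : Finset E) (W' : Submodule ℚ (V → ℚ)),
      finrank ℚ W' < finrank ℚ W → Graphic x' A' → Ctx x' A' W' k →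
      ∀ c c' : E → Fin k, Good x' A' c → Good x' A' c' → Conn x' A' c c')
    (f : E → E) (c c' : E → Fin k) (hc : Good x A c) (hc' : Good x A c')
    (hP : Pairs (Dv x A v) c f) (hP' : Pairs (Dv x A v) c' f) : Conn x A c c' := by
  classical
  set D := Dv x A v with hD
  let num := Fintype.equivFin E
  set R : Finset E := D.filter (fun e => num e < num (f e)) with hR
  have Rsub : ∀ e ∈ R, e ∈ Dv x A v ∧ f e ≠ e := by
    intro e he
    rw [hR, Finset.mem_filter] at he
    refine ⟨he.1, fun h => ?_⟩
    rw [h] at he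
    exact lt_irrefl _ he.2
  have Rpair : ∀ e ∈ Dv x A v, f e ≠ e → (e ∈ R ↔ f e ∉ R) := by
    intro e he hfe
    have h1 := hP.mem e he
    have h2 : num (f e) ≠ num e := fun h => hfe (num.injective h)
    simp only [hR, Finset.mem_filter, hP.inv, not_and, not_lt]
    constructor
    · intro h _; exact h.2.le
    · intro h
      exact ⟨he, lt_of_le_of_ne (h h1) h2.symm⟩
  have hcount := hP.count (hne c hc)
  have hk0 : k ≤ D.card := by
    have : (Finset.univ : Finset (Fin k)) ⊆ D.image c := by
      intro i _
      obtain ⟨e, he, h⟩ := hne c hc i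
      exact Finset.mem_image.2 ⟨e, he, h⟩
    have := (Finset.card_le_card this).trans Finset.card_image_le
    simpa using this
  have hRcard : D.card = R.card + k := by
    have h1 : (Finset.univ.filter (fun e => f e ≠ e)) = R ∪ R.image f := by
      ext e
      simp only [Finset.mem_filter, Finset.mem_univ, true_and, Finset.mem_union, Finset.mem_image]
      constructor
      · intro h
        have he : e ∈ D := by
          by_contra h2; exact h (hP.off e h2)
        by_cases h3 : e ∈ R
        · exact Or.inl h3
        · right
          refine ⟨f e, ?_, hP.inv e⟩
          by_contra h4
          exact h3 ((Rpair e he h).2 h4)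
      · rintro (h | ⟨b, hb, rfl⟩)
        · exact (Rsub e h).2
        · rw [hP.inv]; exact (Rsub b hb).2.symm
    have h2 : Disjoint R (R.image f) := by
      rw [Finset.disjoint_left]
      intro e he he2
      obtain ⟨b, hb, rfl⟩ := Finset.mem_image.1 he2
      exact (Rpair b (Rsub b hb).1 (Rsub b hb).2).1 hb he
    rw [h1, Finset.card_union_of_disjoint h2, Finset.card_image_of_injective] at hcount
    · omega
    · exact Function.LeftInverse.injective hP.inv
  obtain ⟨s, hs, hfs⟩ : ∃ s ∈ D, f s = s := by
    by_contra hno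
    push Not at hno
    have : D ⊆ Finset.univ.filter (fun e => f e ≠ e) := by
      intro e he; simp [hno e he]
    have := Finset.card_le_card this
    omega
  have hDA : D ⊆ A := fun e he => Dsub he
  have hscard : (sA x A v R).card + k = A.card := by
    have h1 : Disjoint (A \ D) R := by
      rw [Finset.disjoint_left]
      intro e he h2
      exact (Finset.mem_sdiff.1 he).2 (Rsub e h2).1
    have h2 : (sA x A v R).card = (A \ D).card + R.card := by
      unfold sA; exact Finset.card_union_of_disjoint h1
    have h3 := Finset.card_sdiff_add_card_eq_card hDA
    omega
  set W' : Submodule ℚ (V → ℚ) := W ⊓ LinearMap.ker (LinearMap.proj v : (V → ℚ) →ₗ[ℚ] ℚ) with hW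
  have hW' : ∀ w, w ∈ W' ↔ w ∈ W ∧ w v = 0 := by
    intro w; rw [hW, Submodule.mem_inf, LinearMap.mem_ker]; rfl
  have hlt : finrank ℚ W' < finrank ℚ W := by
    apply Submodule.finrank_lt_finrank_of_lt
    refine lt_of_le_of_ne inf_le_left (fun h => ?_)
    have h1 : x s ∈ W' := by rw [h]; exact C.mem s (Dsub hs)
    have := ((hW' _).1 h1).2
    rw [(mem_Dv.1 hs).2] at this
    norm_num at this
  have cardA := C.card_eq hc
  have C' : Ctx (sx x f R) (sA x A v R) W' k := by
    constructor
    · intro e he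
      rw [hW']
      by_cases heR : e ∈ R
      · have h1 := Rsub e heR
        have h2 := hP.mem e h1.1
        simp only [sx, heR, if_true]
        refine ⟨W.sub_mem (C.mem _ (Dsub h1.1)) (C.mem _ (Dsub h2)), ?_⟩
        rw [Pi.sub_apply, (mem_Dv.1 h1.1).2, (mem_Dv.1 h2).2, sub_self]
      · simp only [sx, heR, if_false]
        rcases mem_sA.1 he with h | h
        · refine ⟨C.mem _ h.1, ?_⟩
          rcases hv e h.1 with h3 | h3
          · exact h3
          · exact absurd (mem_Dv.2 ⟨h.1, h3⟩) h.2
        · exact absurd h heR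
    · have : k * (finrank ℚ W' + 1) ≤ k * finrank ℚ W := Nat.mul_le_mul_left k hlt
      rw [Nat.mul_add] at this
      omega
  have hg := restrict_good hc hP Rsub Rpair
  have hg' := restrict_good hc' hP' Rsub Rpair
  have rk : finrank ℚ W' + 1 = finrank ℚ W := by
    have h1 := C'.card_eq hg
    have h2 : k * (finrank ℚ W' + 1) = k * finrank ℚ W := by
      rw [Nat.mul_add]; omega
    exact Nat.eq_of_mul_eq_mul_left (by omega) h2
  have hG' : Graphic (sx x f R) (sA x A v R) := by
    intro e he
    by_cases heR : e ∈ R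
    · have h1 := Rsub e heR
      have h2 := hP.mem e h1.1
      simp only [sx, heR, if_true]
      obtain ⟨u, w, h3⟩ := hG e (Dsub h1.1)
      obtain ⟨u', w', h4⟩ := hG (f e) (Dsub h2)
      obtain ⟨rfl, -⟩ := eq_of_apply_one h3 (mem_Dv.1 h1.1).2
      obtain ⟨rfl, -⟩ := eq_of_apply_one h4 (mem_Dv.1 h2).2
      refine ⟨w', w, ?_⟩
      rw [h3, h4]; abel
    · simp only [sx, heR, if_false]
      rcases mem_sA.1 he with h | h
      · exact hG e h.1
      · exact absurd h heR
  have S : LS x A W W' v f R k := ⟨C, hv, hne, hP.inv, hP.mem, Rsub, Rpair, C', hW', rk, cardA⟩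
  exact S.lift_conn hk hg (IH _ _ _ hlt hG' C' c c' hg hg') hs hfs c c'
    (lift_self hc hP Rsub) (lift_self hc' hP' Rsub)

end build
end KB

namespace KB
set_option linter.unusedSectionVars false
set_option linter.unusedVariables false
open Module Submodule

section main
variable {V E : Type*} [Fintype V] [Fintype E] [DecidableEq V] [DecidableEq E] {k : ℕ}

lemma dim_lt {x : E → V → ℚ} {T : Finset E} (hG : Graphic x T)
    (h : LinearIndepOn ℚ x (T : Set E)) (hne : T.Nonempty) (V' : Finset V)
    (hV : ∀ e ∈ T, ∀ u, x e u ≠ 0 → u ∈ V') : T.card < V'.card := by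
  set S : Submodule ℚ (V → ℚ) := span ℚ ((V'.image (fun u => (Pi.single u 1 : V → ℚ)) :
    Finset (V → ℚ)) : Set (V → ℚ)) with hS
  have h1 : finrank ℚ S ≤ V'.card := (finrank_span_finset_le_card _).trans Finset.card_image_le
  have hsing : ∀ u ∈ V', (Pi.single u 1 : V → ℚ) ∈ S := by
    intro u hu
    apply subset_span
    rw [Finset.mem_coe, Finset.mem_image]
    exact ⟨u, hu, rfl⟩
  have hle : span ℚ (x '' (T : Set E)) ≤ S := by
    rw [span_le]
    rintro _ ⟨e, he, rfl⟩
    have : x e = ∑ u, x e u • (Pi.single u 1 : V → ℚ) := by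
      ext w; simp [Finset.sum_apply, Pi.single_apply]
    rw [this]
    refine S.sum_mem (fun u _ => ?_)
    by_cases hu : x e u = 0
    · rw [hu, zero_smul]; exact S.zero_mem
    · exact S.smul_mem _ (hsing u (hV e he u hu))
  obtain ⟨e, he⟩ := hne
  have hxe : x e ≠ 0 := h.ne_zero he
  obtain ⟨v0, hv0⟩ := Function.ne_iff.1 hxe
  have hv0V := hV e he v0 hv0
  have hn : (Pi.single v0 1 : V → ℚ) ∉ span ℚ (x '' (T : Set E)) := by
    apply notMem_span_of_dual (∑ u, LinearMap.proj u : (V → ℚ) →ₗ[ℚ] ℚ)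
    · intro t ht
      obtain ⟨u, w, huw⟩ := hG t ht
      rw [huw]
      simp [LinearMap.sum_apply, Pi.single_apply]
    · simp [LinearMap.sum_apply, Pi.single_apply]
  have hlt : span ℚ (x '' (T : Set E)) < S := by
    refine lt_of_le_of_ne hle (fun hh => hn ?_)
    rw [hh]; exact hsing v0 hv0V
  have := Submodule.finrank_lt_finrank_of_lt hlt
  rw [finrank_span_indep h] at this
  omega

lemma exists_low {x : E → V → ℚ} {A : Finset E} {W : Submodule ℚ (V → ℚ)} (hk : 3 ≤ k)
    (hG : Graphic x A) (C : Ctx x A W k) {c : E → Fin k} (hc : Good x A c)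
    (hr : 0 < finrank ℚ W) :
    ∃ v, 0 < (A.filter (fun e => x e v ≠ 0)).card ∧ (A.filter (fun e => x e v ≠ 0)).card < 2 * k := by
  classical
  set V' : Finset V := Finset.univ.filter (fun u => ∃ e ∈ A, x e u ≠ 0) with hV'
  let i0 : Fin k := ⟨0, by omega⟩
  have hT := C.card_cls hc i0
  have hlt : (cls A c i0).card < V'.card := by
    apply dim_lt (fun e he => hG e (cls_subset _ _ _ he)) (hc i0)
    · rw [← Finset.card_pos]; omega
    · intro e he u hu
      rw [hV', Finset.mem_filter]
      exact ⟨Finset.mem_univ _, e, cls_subset _ _ _ he, hu⟩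
  by_contra hno
  push Not at hno
  have h1 : V'.card * (2 * k) ≤ A.card * 2 := by
    refine Finset.card_mul_le_card_mul (fun u e => x e u ≠ 0) ?_ ?_
    · intro u hu
      rw [hV', Finset.mem_filter] at hu
      obtain ⟨-, e, he, hx⟩ := hu
      exact hno u (Finset.card_pos.2 ⟨e, Finset.mem_filter.2 ⟨he, hx⟩⟩)
    · intro e he
      obtain ⟨u, w, huw⟩ := hG e he
      refine (Finset.card_le_card (t := {u, w}) ?_).trans Finset.card_le_two
      intro z hz
      simp only [Finset.bipartiteBelow, Finset.mem_filter] at hz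
      have := hz.2
      rw [huw] at this
      simp only [Finset.mem_insert, Finset.mem_singleton]
      by_contra hzz
      push Not at hzz
      apply this
      simp [hzz.1, hzz.2]
  have h2 := C.card_eq hc
  rw [h2] at h1
  have h3 : (finrank ℚ W + 1) * (2 * k) ≤ V'.card * (2 * k) := Nat.mul_le_mul_right _ (by omega)
  have h4 : (finrank ℚ W + 1) * (2 * k) = k * finrank ℚ W * 2 + 2 * k := by ring
  omega

lemma good_smul {x : E → V → ℚ} {A : Finset E} {c : E → Fin k} (ε : E → ℚˣ) (h : Good x A c) :
    Good (fun e => ε e • x e) A c := by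
  intro i
  have h1 : LinearIndependent ℚ (fun e : (cls A c i : Set E) => x e) := h i
  have := h1.units_smul (fun e => ε e)
  exact this

lemma conn_smul {x : E → V → ℚ} {A : Finset E} {c c' : E → Fin k} (ε : E → ℚˣ)
    (h : Conn x A c c') : Conn (fun e => ε e • x e) A c c' := by
  refine Relation.ReflTransGen.lift id ?_ _ _ h
  rintro a b ⟨h1, h2, h3⟩
  exact ⟨good_smul ε h1, good_smul ε h2, h3⟩

theorem color_conn (hk : 3 ≤ k) : ∀ (n : ℕ) (x : E → V → ℚ) (A : Finset E)
    (W : Submodule ℚ (V → ℚ)), finrank ℚ W ≤ n → Graphic x A → Ctx x A W k →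
    ∀ c c' : E → Fin k, Good x A c → Good x A c' → Conn x A c c' := by
  intro n
  induction n using Nat.strong_induction_on with
  | _ n ih =>
  intro x A W hn hG C c c' hc hc'
  by_cases hr : finrank ℚ W = 0
  · have h1 := C.card_eq hc
    rw [hr, Nat.mul_zero, Finset.card_eq_zero] at h1
    refine Step.conn ⟨hc, hc', ⟨0, by omega⟩, ?_⟩
    simp [h1]
  obtain ⟨v, hv1, hv2⟩ := exists_low hk hG C hc (Nat.pos_of_ne_zero hr)
  set ε : E → ℚˣ := fun e => if x e v = -1 then -1 else 1 with hε
  set y : E → V → ℚ := fun e => ε e • x e with hy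
  have hye : ∀ e, (x e v = -1 ∧ y e = - x e) ∨ (x e v ≠ -1 ∧ y e = x e) := by
    intro e
    by_cases h : x e v = -1
    · left; simp [hy, hε, h]
    · right; simp [hy, hε, h]
  have hx3 : ∀ e ∈ A, x e v = 0 ∨ x e v = 1 ∨ x e v = -1 := by
    intro e he
    obtain ⟨u, w, huw⟩ := hG e he
    rw [huw]
    simp only [Pi.sub_apply, Pi.single_apply]
    split_ifs <;> norm_num
  have hyG : Graphic y A := by
    intro e he
    obtain ⟨u, w, huw⟩ := hG e he
    rcases hye e with ⟨-, h⟩ | ⟨-, h⟩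
    · exact ⟨w, u, by rw [h, huw, neg_sub]⟩
    · exact ⟨u, w, by rw [h, huw]⟩
  have hyC : Ctx y A W k := by
    refine ⟨fun e he => ?_, C.card⟩
    rcases hye e with ⟨-, h⟩ | ⟨-, h⟩
    · rw [h]; exact W.neg_mem (C.mem e he)
    · rw [h]; exact C.mem e he
  have hyv : ∀ e ∈ A, y e v = 0 ∨ y e v = 1 := by
    intro e he
    rcases hye e with ⟨h1, h⟩ | ⟨h1, h⟩
    · right; rw [h, Pi.neg_apply, h1, neg_neg]
    · rw [h]
      rcases hx3 e he with h2 | h2 | h2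
      · exact Or.inl h2
      · exact Or.inr h2
      · exact absurd h2 h1
  have hD : Dv y A v = A.filter (fun e => x e v ≠ 0) := by
    ext e
    rw [mem_Dv, Finset.mem_filter]
    refine and_congr_right (fun he => ?_)
    rcases hye e with ⟨h1, h⟩ | ⟨h1, h⟩
    · rw [h, Pi.neg_apply, h1]; norm_num
    · rw [h]
      rcases hx3 e he with h2 | h2 | h2
      · rw [h2]; norm_num
      · rw [h2]; norm_num
      · exact absurd h2 h1
  have hd : (Dv y A v).card < 2 * k := by rw [hD]; exact hv2
  obtain ⟨e0, he0⟩ : (Dv y A v).Nonempty := by rw [← Finset.card_pos, hD]; exact hv1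
  have hne : ∀ c : E → Fin k, Good y A c → ∀ i, ∃ e ∈ Dv y A v, c e = i := by
    intro c hc i
    by_contra hno
    push Not at hno
    have h1 : y e0 ∈ span ℚ (y '' (cls A c i : Set E)) := by
      rw [hyC.span_cls hc i]; exact hyC.mem e0 (Dsub he0)
    refine notMem_span_of_dual (LinearMap.proj v : (V → ℚ) →ₗ[ℚ] ℚ) ?_ ?_ h1
    · intro t ht
      have ht := mem_cls.1 ht
      rcases hyv t ht.1 with h | h
      · exact h
      · exact absurd ht.2 (hno t (mem_Dv.2 ⟨ht.1, h⟩))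
    · simp [(mem_Dv.1 he0).2]
  have IH : ∀ (x' : E → V → ℚ) (A' : Finset E) (W' : Submodule ℚ (V → ℚ)),
      finrank ℚ W' < finrank ℚ W → Graphic x' A' → Ctx x' A' W' k →
      ∀ c c' : E → Fin k, Good x' A' c → Good x' A' c' → Conn x' A' c c' := by
    intro x' A' W' hlt hG' C' c c' h h'
    exact ih (finrank ℚ W') (by omega) x' A' W' le_rfl hG' C' c c' h h'
  have hyc : Good y A c := good_smul ε hc
  have hyc' : Good y A c' := good_smul ε hc'
  obtain ⟨d, d1, d2, d3⟩ := reduce hk hyC hyG hne hd _ c hyc le_rfl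
  obtain ⟨d', d1', d2', d3'⟩ := reduce hk hyC hyG hne hd _ c' hyc' le_rfl
  have hcon := pairs_conn hk hyC hyG hne
    (fun f a b ha hb hpa hpb => split_conn hk hyC hyG hyv hne hd IH f a b ha hb hpa hpb)
    d d' d1 d1' d3 d3'
  have hfin : Conn y A c c' := d2.trans (hcon.trans d2'.symm)
  have := conn_smul (fun e => (ε e)⁻¹) hfin
  simpa [hy] using this

end main
end KB

namespace KB
set_option linter.unusedSectionVars false
set_option linter.unusedVariables false
open Module Submodule

section conv
variable {V E : Type*} [Fintype V] [Fintype E] [DecidableEq V] [DecidableEq E] {k : ℕ}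

/-- the incidence vectors -/
def vec (ends : E → V × V) : E → V → ℚ :=
  fun e => Pi.single (ends e).1 1 - Pi.single (ends e).2 1

lemma forest_iff (ends : E → V × V) (S : Finset E) :
    IsForest ends S ↔ LinearIndepOn ℚ (vec ends) (S : Set E) := by
  classical
  constructor
  · intro h
    by_contra hn
    rw [not_linearIndepOn_finset_iff] at hn
    obtain ⟨f, hf, e0, he0, hfe⟩ := hn
    set T := S.filter (fun e => f e ≠ 0) with hT
    have hlt := h T (Finset.filter_subset _ _) ⟨e0, by rw [hT, Finset.mem_filter]; exact ⟨he0, hfe⟩⟩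
    set T1 : V → Finset E := fun z => T.filter (fun e => (ends e).1 = z) with hT1
    set T2 : V → Finset E := fun z => T.filter (fun e => (ends e).2 = z) with hT2
    have hz : ∀ z, ∑ e ∈ T1 z, f e - ∑ e ∈ T2 z, f e = 0 := by
      intro z
      have h1 := congrFun hf z
      rw [Finset.sum_apply] at h1
      have h2 : ∑ e ∈ T, (f e • vec ends e) z = 0 := by
        rw [← Pi.zero_apply (M := fun _ : V => ℚ) z, ← h1]
        apply Finset.sum_subset (Finset.filter_subset _ _)
        intro e he hne
        have : f e = 0 := by
          by_contra h3
          exact hne (Finset.mem_filter.2 ⟨he, h3⟩)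
        simp [this]
      have q1 : ∑ e ∈ T1 z, f e = ∑ e ∈ T, if (ends e).1 = z then f e else 0 :=
        Finset.sum_filter _ _
      have q2 : ∑ e ∈ T2 z, f e = ∑ e ∈ T, if (ends e).2 = z then f e else 0 :=
        Finset.sum_filter _ _
      rw [q1, q2, ← Finset.sum_sub_distrib]
      refine Eq.trans (Finset.sum_congr rfl ?_) h2
      intro e he
      simp only [vec, Pi.smul_apply, Pi.sub_apply, Pi.single_apply, smul_eq_mul,
        eq_comm (a := z)]
      split_ifs <;> ring
    have hcount : ∀ z ∈ edgeVerts ends T, 2 ≤ (T1 z).card + (T2 z).card := by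
      rintro z ⟨e, he, hez⟩
      by_contra hlt2
      have hfe : f e ≠ 0 := by rw [hT, Finset.mem_filter] at he; exact he.2
      have h0 := hz z
      rcases hez with hez | hez
      · have m : e ∈ T1 z := by rw [hT1, Finset.mem_filter]; exact ⟨he, hez⟩
        have p := Finset.card_pos.2 ⟨e, m⟩
        have q1 : (T1 z).card = 1 := by omega
        have q2 : T2 z = ∅ := by rw [← Finset.card_eq_zero]; omega
        obtain ⟨a, ha⟩ := Finset.card_eq_one.1 q1
        rw [ha, Finset.mem_singleton] at m
        subst m
        rw [ha, q2] at h0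
        simp at h0
        exact hfe h0
      · have m : e ∈ T2 z := by rw [hT2, Finset.mem_filter]; exact ⟨he, hez⟩
        have p := Finset.card_pos.2 ⟨e, m⟩
        have q1 : (T2 z).card = 1 := by omega
        have q2 : T1 z = ∅ := by rw [← Finset.card_eq_zero]; omega
        obtain ⟨a, ha⟩ := Finset.card_eq_one.1 q1
        rw [ha, Finset.mem_singleton] at m
        subst m
        rw [ha, q2] at h0
        simp at h0
        exact hfe h0
    have e1 : ∑ z, (T1 z).card = T.card :=
      (Finset.card_eq_sum_card_fiberwise (f := fun e => (ends e).1) (t := Finset.univ)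
        (by simp)).symm
    have e2 : ∑ z, (T2 z).card = T.card :=
      (Finset.card_eq_sum_card_fiberwise (f := fun e => (ends e).2) (t := Finset.univ)
        (by simp)).symm
    have hfin : (edgeVerts ends T).toFinset.card * 2 ≤ T.card + T.card := by
      rw [← smul_eq_mul]
      calc (edgeVerts ends T).toFinset.card • 2
          ≤ ∑ z ∈ (edgeVerts ends T).toFinset, ((T1 z).card + (T2 z).card) :=
            Finset.card_nsmul_le_sum _ _ _ (fun z hz => hcount z (by simpa using hz))
        _ ≤ ∑ z, ((T1 z).card + (T2 z).card) :=
            Finset.sum_le_sum_of_subset (Finset.subset_univ _)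
        _ = T.card + T.card := by rw [Finset.sum_add_distrib, e1, e2]
    rw [Set.ncard_eq_toFinset_card'] at hlt
    omega
  · intro h T hTS hne
    rw [Set.ncard_eq_toFinset_card']
    apply dim_lt (x := vec ends) (fun e he => ⟨_, _, rfl⟩) (h.mono (by exact_mod_cast hTS)) hne
    intro e he u hu
    rw [Set.mem_toFinset]
    refine ⟨e, he, ?_⟩
    by_contra hno
    push Not at hno
    apply hu
    simp [vec, hno.1.symm, hno.2.symm]

/-- the span of all incidence vectors -/
def WW (ends : E → V × V) : Submodule ℚ (V → ℚ) := span ℚ (Set.range (vec ends))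

lemma mem_WW (ends : E → V × V) (e : E) : vec ends e ∈ WW ends := subset_span ⟨e, rfl⟩

lemma spanning_iff (ends : E → V × V) (B : Finset E) :
    IsSpanningForest ends B ↔
      LinearIndepOn ℚ (vec ends) (B : Set E) ∧ B.card = finrank ℚ (WW ends) := by
  unfold IsSpanningForest
  rw [forest_iff]
  refine and_congr_right (fun hB => ?_)
  constructor
  · intro h
    rw [← finrank_span_indep hB]
    suffices hs : span ℚ (vec ends '' (B : Set E)) = WW ends by rw [hs]
    apply le_antisymm (span_le_W (fun e _ => mem_WW ends e) (Finset.subset_univ B))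
    unfold WW
    rw [span_le]
    rintro _ ⟨e, rfl⟩
    by_contra hn
    by_cases he : e ∈ B
    · exact hn (subset_span ⟨e, he, rfl⟩)
    · apply h e he
      rw [forest_iff, Finset.coe_insert]
      exact hB.insert hn
  · intro h e he hf
    rw [forest_iff] at hf
    have := card_le_of_indep hf (fun e _ => mem_WW ends e)
    rw [Finset.card_insert_of_notMem he] at this
    omega

/-- the vertex of the base graph given by a colouring -/
def PC (c : E → Fin k) : Finset (Finset E) := Finset.univ.image (cls Finset.univ c)

lemma PC_vertex (ends : E → V × V) {c : E → Fin k}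
    (C : Ctx (vec ends) Finset.univ (WW ends) k) (hr : 0 < finrank ℚ (WW ends))
    (hc : Good (vec ends) Finset.univ c) : IsKBaseVertex ends k (PC c) := by
  refine ⟨?_, ?_, ?_, ?_⟩
  · unfold PC
    rw [Finset.card_image_of_injective]
    · simp
    · intro i j hij
      have h1 := C.card_cls hc i
      obtain ⟨e, he⟩ := Finset.card_pos.1 (h1 ▸ hr)
      have h2 := (mem_cls.1 he).2
      rw [show cls Finset.univ c i = cls Finset.univ c j from hij] at he
      exact h2.symm.trans (mem_cls.1 he).2
  · intro B hB
    obtain ⟨i, -, rfl⟩ := Finset.mem_image.1 hB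
    rw [spanning_iff]
    exact ⟨hc i, C.card_cls hc i⟩
  · intro B hB B' hB' hne
    obtain ⟨i, -, rfl⟩ := Finset.mem_image.1 hB
    obtain ⟨j, -, rfl⟩ := Finset.mem_image.1 hB'
    show Disjoint (cls Finset.univ c i) (cls Finset.univ c j)
    rw [Finset.disjoint_left]
    intro e he he'
    apply hne
    rw [← (mem_cls.1 he).2, ← (mem_cls.1 he').2]
  · ext e
    simp only [Finset.mem_biUnion, Finset.mem_univ, iff_true, id]
    exact ⟨cls Finset.univ c (c e), Finset.mem_image.2 ⟨c e, Finset.mem_univ _, rfl⟩,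
      mem_cls.2 ⟨Finset.mem_univ _, rfl⟩⟩

lemma exists_color (ends : E → V × V) {P : Finset (Finset E)} (hP : IsKBaseVertex ends k P) :
    ∃ c : E → Fin k, Good (vec ends) Finset.univ c ∧ PC c = P := by
  obtain ⟨h1, h2, h3, h4⟩ := hP
  let σ := P.equivFinOfCardEq h1
  have hex : ∀ e : E, ∃ B : P, e ∈ B.1 := by
    intro e
    have : e ∈ P.biUnion id := by rw [h4]; exact Finset.mem_univ _
    obtain ⟨B, hB, he⟩ := Finset.mem_biUnion.1 this
    exact ⟨⟨B, hB⟩, he⟩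
  choose blk hblk using hex
  have hcls : ∀ i, cls Finset.univ (fun e => σ (blk e)) i = (σ.symm i).1 := by
    intro i
    ext e
    rw [mem_cls]
    constructor
    · rintro ⟨-, h⟩
      rw [← h, Equiv.symm_apply_apply]
      exact hblk e
    · intro h
      refine ⟨Finset.mem_univ _, ?_⟩
      rw [← Equiv.eq_symm_apply]
      by_contra hne
      have := h3 (blk e).2 (σ.symm i).2 (fun h => hne (Subtype.ext h))
      exact Finset.disjoint_left.1 this (hblk e) h
  refine ⟨fun e => σ (blk e), ?_, ?_⟩
  · intro i
    rw [hcls i]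
    exact ((spanning_iff ends _).1 (h2 _ (σ.symm i).2)).1
  · unfold PC
    ext B
    rw [Finset.mem_image]
    constructor
    · rintro ⟨i, -, rfl⟩
      rw [hcls i]; exact (σ.symm i).2
    · intro hB
      exact ⟨σ ⟨B, hB⟩, Finset.mem_univ _, by rw [hcls, Equiv.symm_apply_apply]⟩

end conv
end KB

/-- **Theorem 4 (the `k`-base graph is connected).** For `k ≥ 3` and a multigraph `G` with
`k·r` edges whose cycle matroid has rank `r`, the `k`-base graph `𝔊_k(M(G))` is connected:
any two sets of `k` disjoint bases are joined by a path in which consecutive vertices share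
a common base. -/
theorem k_base_graph_connected {V E : Type*} [Fintype V] [Fintype E]
    [DecidableEq V] [DecidableEq E] (ends : E → V × V) (r k : ℕ) (hk : 3 ≤ k)
    (hrank : ∀ B : Finset E, IsSpanningForest ends B → B.card = r)
    (hE : Fintype.card E = k * r)
    (P Q : Finset (Finset E)) (hP : IsKBaseVertex ends k P) (hQ : IsKBaseVertex ends k Q) :
    Relation.ReflTransGen
      (fun A B => IsKBaseVertex ends k A ∧ IsKBaseVertex ends k B ∧ (A ∩ B).Nonempty)
      P Q := by
  obtain ⟨c, hc, rfl⟩ := KB.exists_color ends hP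
  obtain ⟨c', hc', rfl⟩ := KB.exists_color ends hQ
  have hkpos : 0 < (KB.PC c).card := by rw [hP.1]; omega
  obtain ⟨B, hB⟩ := Finset.card_pos.1 hkpos
  have hBs := hP.2.1 B hB
  have hfr : Module.finrank ℚ (KB.WW ends) = r := by
    rw [← hrank B hBs, ((KB.spanning_iff ends B).1 hBs).2]
  have hr : 0 < Module.finrank ℚ (KB.WW ends) := by
    by_contra h0
    have hall : ∀ B ∈ KB.PC c, B = ∅ := by
      intro B hB
      have := ((KB.spanning_iff ends B).1 (hP.2.1 B hB)).2
      rw [← Finset.card_eq_zero]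
      omega
    have : KB.PC c ⊆ {∅} := fun B hB => Finset.mem_singleton.2 (hall B hB)
    have := Finset.card_le_card this
    rw [hP.1, Finset.card_singleton] at this
    omega
  have C : KB.Ctx (KB.vec ends) Finset.univ (KB.WW ends) k := by
    refine ⟨fun e _ => KB.mem_WW ends e, ?_⟩
    rw [hfr, Finset.card_univ, hE]
  have hconn := KB.color_conn hk _ (KB.vec ends) Finset.univ (KB.WW ends) le_rfl
    (fun e _ => ⟨_, _, rfl⟩) C c c' hc hc'
  refine Relation.ReflTransGen.lift KB.PC ?_ _ _ hconn
  rintro a b ⟨ha, hb, i, hi⟩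
  refine ⟨KB.PC_vertex ends C hr ha, KB.PC_vertex ends C hr hb, KB.cls Finset.univ a i, ?_⟩
  rw [Finset.mem_inter]
  refine ⟨Finset.mem_image.2 ⟨i, Finset.mem_univ _, rfl⟩,
    Finset.mem_image.2 ⟨i, Finset.mem_univ _, ?_⟩⟩
  ext e
  rw [KB.mem_cls, KB.mem_cls, hi e (Finset.mem_univ e)]
end
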